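/- Let δ be a real number with δ ∉ {−1, 0, 1}. There exists no smooth function I : T*U → ℝ which is polynomial in momenta of degree ≤ 2 such that the four functions H_δ, p_φ, p_t, I are functionally independent and pairwise Poisson-commute. -/

import Mathlib

open Real Finset

noncomputable section

/-- A phase-space point `(x, y, φ, t, p_x, p_y, p_φ, p_t)` of `T*U ⊂ ℝ⁴ × ℝ⁴`. -/
abbrev PhasePt := Fin 8 → ℝ

/-- The phase space `T*U` over `U = {x > 1, -1 < y < 1}`. -/
def TStar : Set PhasePt := {z | 1 < z 0 ∧ -1 < z 1 ∧ z 1 < 1}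

/-- The base domain `U`. -/
def Ubase : Set (Fin 4 → ℝ) := {w | 1 < w 0 ∧ -1 < w 1 ∧ w 1 < 1}

/-- Projection to the base coordinates `(x, y, φ, t)`. -/
def basePt (z : PhasePt) : Fin 4 → ℝ := fun q => z ⟨q.1, by omega⟩

/-- Partial derivative in the `i`-th coordinate. -/
def pd (i : Fin 8) (f : PhasePt → ℝ) (z : PhasePt) : ℝ :=
  fderiv ℝ f z (Pi.single i 1)

/-- The canonical Poisson bracket on `T*U`. -/
def pois (f g : PhasePt → ℝ) (z : PhasePt) : ℝ :=
    (pd 0 f z * pd 4 g z - pd 4 f z * pd 0 g z)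
  + (pd 1 f z * pd 5 g z - pd 5 f z * pd 1 g z)
  + (pd 2 f z * pd 6 g z - pd 6 f z * pd 2 g z)
  + (pd 3 f z * pd 7 g z - pd 7 f z * pd 3 g z)

/-- The geodesic Hamiltonian of the Zipoy-Voorhees metric with parameter `δ = 2`. -/
def Ham (z : PhasePt) : ℝ :=
  (1/2) * ( (((z 0)^2 - 1) * (z 4)^2 + (1 - (z 1)^2) * (z 5)^2)
      / ((((z 0 + 1)/(z 0 - 1))^2) * (((z 0)^2 - 1)^4 / ((z 0)^2 - (z 1)^2)^3))
    + (z 6)^2 / ((((z 0 + 1)/(z 0 - 1))^2) * (((z 0)^2 - 1) * (1 - (z 1)^2)))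
    - ((z 0 + 1)/(z 0 - 1))^2 * (z 7)^2 )

/-- The momentum `p_φ`. -/
def Pphi (z : PhasePt) : ℝ := z 6

/-- The momentum `p_t`. -/
def Ptm (z : PhasePt) : ℝ := z 7

/-- `I` is polynomial in momenta of degree `≤ d`, with smooth coefficients. -/
def IsPolyMom (d : ℕ) (I : PhasePt → ℝ) : Prop :=
  ∃ c : ℕ → ℕ → ℕ → ℕ → ((Fin 4 → ℝ) → ℝ),
    (∀ i j k m, ContDiffOn ℝ (⊤ : ℕ∞) (c i j k m) Ubase) ∧
    ∀ z ∈ TStar, I z =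
      ∑ i ∈ Finset.range (d+1), ∑ j ∈ Finset.range (d+1),
      ∑ k ∈ Finset.range (d+1), ∑ m ∈ Finset.range (d+1),
        (if i + j + k + m ≤ d then
          c i j k m (basePt z) * (z 4)^i * (z 5)^j * (z 6)^k * (z 7)^m else 0)

/-- `I` is a homogeneous polynomial in momenta of degree `d`, with smooth coefficients. -/
def IsHomPolyMom (d : ℕ) (I : PhasePt → ℝ) : Prop :=
  ∃ c : ℕ → ℕ → ℕ → ℕ → ((Fin 4 → ℝ) → ℝ),
    (∀ i j k m, ContDiffOn ℝ (⊤ : ℕ∞) (c i j k m) Ubase) ∧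
    ∀ z ∈ TStar, I z =
      ∑ i ∈ Finset.range (d+1), ∑ j ∈ Finset.range (d+1),
      ∑ k ∈ Finset.range (d+1), ∑ m ∈ Finset.range (d+1),
        (if i + j + k + m = d then
          c i j k m (basePt z) * (z 4)^i * (z 5)^j * (z 6)^k * (z 7)^m else 0)

/-- Functional independence: the differentials are linearly independent at every point
of a dense subset of `T*U`. -/
def FunIndep (f₁ f₂ f₃ f₄ : PhasePt → ℝ) : Prop :=
  ∃ S : Set PhasePt, S ⊆ TStar ∧ TStar ⊆ closure S ∧
    ∀ z ∈ S, LinearIndependent ℝ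
      ![fderiv ℝ f₁ z, fderiv ℝ f₂ z, fderiv ℝ f₃ z, fderiv ℝ f₄ z]


/-- The geodesic Hamiltonian of the Zipoy-Voorhees metric with real parameter `δ`
(real powers of the positive quantities `(x+1)/(x-1)` and `(x²-1)/(x²-y²)`). -/
def HamD (d : ℝ) (z : PhasePt) : ℝ :=
  (1/2) * ( (((z 0)^2 - 1) * (z 4)^2 + (1 - (z 1)^2) * (z 5)^2)
      / ( ((z 0 + 1)/(z 0 - 1)) ^ d *
          ( ((z 0)^2 - (z 1)^2) * ( (((z 0)^2 - 1)/((z 0)^2 - (z 1)^2)) ^ (d^2) ) ) )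
    + (z 6)^2 / ( ((z 0 + 1)/(z 0 - 1)) ^ d * (((z 0)^2 - 1) * (1 - (z 1)^2)) )
    - ((z 0 + 1)/(z 0 - 1)) ^ d * (z 7)^2 )



/-- The open base region used for the local analysis. -/
def Om : Set (ℝ × ℝ) := {p | 1 < p.1 ∧ 0 < p.2 ∧ p.2 < 1}

/-- partial derivative in the first variable -/
def dX (f : ℝ → ℝ → ℝ) : ℝ → ℝ → ℝ := fun x y => deriv (fun s => f s y) x
/-- partial derivative in the second variable -/
def dY (f : ℝ → ℝ → ℝ) : ℝ → ℝ → ℝ := fun x y => deriv (fun s => f x s) y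

/-- smoothness of a two-variable function on `Om` -/
def Sm (f : ℝ → ℝ → ℝ) : Prop := ContDiffOn ℝ (⊤ : ℕ∞) (fun p : ℝ × ℝ => f p.1 p.2) Om

lemma isOpen_Om : IsOpen Om := by
  have : Om = {p : ℝ × ℝ | 1 < p.1} ∩ ({p : ℝ × ℝ | 0 < p.2} ∩ {p : ℝ × ℝ | p.2 < 1}) := by
    ext p; simp [Om]
  rw [this]
  exact (isOpen_lt continuous_const continuous_fst).inter
    ((isOpen_lt continuous_const continuous_snd).inter (isOpen_lt continuous_snd continuous_const))

lemma hasX_of_fd {f : ℝ → ℝ → ℝ} {x y : ℝ}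
    (h : DifferentiableAt ℝ (fun p : ℝ × ℝ => f p.1 p.2) (x, y)) :
    HasDerivAt (fun s => f s y) (fderiv ℝ (fun p : ℝ × ℝ => f p.1 p.2) (x, y) (1, 0)) x := by
  have h1 : HasDerivAt (fun s : ℝ => (s, y)) ((1 : ℝ), (0 : ℝ)) x :=
    (hasDerivAt_id x).prodMk (hasDerivAt_const x y)
  exact HasFDerivAt.comp_hasDerivAt x (f := fun s : ℝ => (s, y)) h.hasFDerivAt h1

lemma hasY_of_fd {f : ℝ → ℝ → ℝ} {x y : ℝ}
    (h : DifferentiableAt ℝ (fun p : ℝ × ℝ => f p.1 p.2) (x, y)) :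
    HasDerivAt (fun s => f x s) (fderiv ℝ (fun p : ℝ × ℝ => f p.1 p.2) (x, y) (0, 1)) y := by
  have h1 : HasDerivAt (fun s : ℝ => (x, s)) ((0 : ℝ), (1 : ℝ)) y :=
    (hasDerivAt_const y x).prodMk (hasDerivAt_id y)
  exact HasFDerivAt.comp_hasDerivAt y (f := fun s : ℝ => (x, s)) h.hasFDerivAt h1

lemma Sm.diffAt {f : ℝ → ℝ → ℝ} (h : Sm f) {p : ℝ × ℝ} (hp : p ∈ Om) :
    DifferentiableAt ℝ (fun p : ℝ × ℝ => f p.1 p.2) p :=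
  ((h.contDiffAt (isOpen_Om.mem_nhds hp)).differentiableAt (by simp))

lemma Sm.hasX {f : ℝ → ℝ → ℝ} (h : Sm f) {x y : ℝ} (hp : (x, y) ∈ Om) :
    HasDerivAt (fun s => f s y) (dX f x y) x :=
  (hasX_of_fd (h.diffAt hp)).differentiableAt.hasDerivAt

lemma Sm.hasY {f : ℝ → ℝ → ℝ} (h : Sm f) {x y : ℝ} (hp : (x, y) ∈ Om) :
    HasDerivAt (fun s => f x s) (dY f x y) y :=
  (hasY_of_fd (h.diffAt hp)).differentiableAt.hasDerivAt

lemma Sm.dX_eq {f : ℝ → ℝ → ℝ} (h : Sm f) {x y : ℝ} (hp : (x, y) ∈ Om) :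
    dX f x y = fderiv ℝ (fun p : ℝ × ℝ => f p.1 p.2) (x, y) (1, 0) :=
  (hasX_of_fd (h.diffAt hp)).deriv

lemma Sm.dY_eq {f : ℝ → ℝ → ℝ} (h : Sm f) {x y : ℝ} (hp : (x, y) ∈ Om) :
    dY f x y = fderiv ℝ (fun p : ℝ × ℝ => f p.1 p.2) (x, y) (0, 1) :=
  (hasY_of_fd (h.diffAt hp)).deriv

lemma Sm.fd {f : ℝ → ℝ → ℝ} (h : Sm f) :
    ContDiffOn ℝ (⊤ : ℕ∞) (fderiv ℝ (fun p : ℝ × ℝ => f p.1 p.2)) Om :=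
  ContDiffOn.fderiv_of_isOpen h isOpen_Om (by simp)

lemma Sm.dX {f : ℝ → ℝ → ℝ} (h : Sm f) : Sm (dX f) := by
  have := h.fd.clm_apply (contDiffOn_const (c := ((1 : ℝ), (0 : ℝ))))
  exact this.congr (fun p hp => h.dX_eq hp)

lemma Sm.dY {f : ℝ → ℝ → ℝ} (h : Sm f) : Sm (dY f) := by
  have := h.fd.clm_apply (contDiffOn_const (c := ((0 : ℝ), (1 : ℝ))))
  exact this.congr (fun p hp => h.dY_eq hp)

lemma Sm.symm {f : ℝ → ℝ → ℝ} (h : Sm f) {x y : ℝ} (hp : (x, y) ∈ Om) :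
    _root_.dX (_root_.dY f) x y = _root_.dY (_root_.dX f) x y := by
  have hn := isOpen_Om.mem_nhds hp
  have hs : IsSymmSndFDerivAt ℝ (fun p : ℝ × ℝ => f p.1 p.2) (x, y) :=
    (h.contDiffAt hn).isSymmSndFDerivAt (by simp; exact WithTop.coe_le_coe.2 (le_top (a := (2:ℕ∞))))
  have hd : DifferentiableAt ℝ (fderiv ℝ (fun p : ℝ × ℝ => f p.1 p.2)) (x, y) :=
    (h.fd.contDiffAt hn).differentiableAt (by simp)
  rw [h.dY.dX_eq hp, h.dX.dY_eq hp]
  have e1 : (fun p : ℝ × ℝ => _root_.dY f p.1 p.2) =ᶠ[nhds (x, y)]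
      fun p => fderiv ℝ (fun p : ℝ × ℝ => f p.1 p.2) p (0, 1) := by
    filter_upwards [hn] with p hp using h.dY_eq hp
  have e2 : (fun p : ℝ × ℝ => _root_.dX f p.1 p.2) =ᶠ[nhds (x, y)]
      fun p => fderiv ℝ (fun p : ℝ × ℝ => f p.1 p.2) p (1, 0) := by
    filter_upwards [hn] with p hp using h.dX_eq hp
  rw [e1.fderiv_eq, e2.fderiv_eq, fderiv_clm_apply hd (by fun_prop), fderiv_clm_apply hd (by fun_prop)]
  simp
  exact hs (1, 0) (0, 1)

lemma evX {x y : ℝ} (hp : (x, y) ∈ Om) : ∀ᶠ s in nhds x, (s, y) ∈ Om := by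
  have : ContinuousAt (fun s : ℝ => (s, y)) x := by fun_prop
  exact this.eventually (isOpen_Om.mem_nhds hp)

lemma evY {x y : ℝ} (hp : (x, y) ∈ Om) : ∀ᶠ s in nhds y, (x, s) ∈ Om := by
  have : ContinuousAt (fun s : ℝ => (x, s)) y := by fun_prop
  exact this.eventually (isOpen_Om.mem_nhds hp)

/-- differentiate an identity valid on `Om` in `x` -/
lemma eqX {f g : ℝ → ℝ → ℝ} (hfg : ∀ x y, (x, y) ∈ Om → f x y = g x y) {x y f' g' : ℝ}
    (hp : (x, y) ∈ Om) (hf : HasDerivAt (fun s => f s y) f' x)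
    (hg : HasDerivAt (fun s => g s y) g' x) : f' = g' := by
  have : (fun s => f s y) =ᶠ[nhds x] fun s => g s y := by
    filter_upwards [evX hp] with s hs using hfg s y hs
  exact hf.unique (hg.congr_of_eventuallyEq this)

/-- differentiate an identity valid on `Om` in `y` -/
lemma eqY {f g : ℝ → ℝ → ℝ} (hfg : ∀ x y, (x, y) ∈ Om → f x y = g x y) {x y f' g' : ℝ}
    (hp : (x, y) ∈ Om) (hf : HasDerivAt (fun s => f x s) f' y)
    (hg : HasDerivAt (fun s => g x s) g' y) : f' = g' := by
  have : (fun s => f x s) =ᶠ[nhds y] fun s => g x s := by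
    filter_upwards [evY hp] with s hs using hfg x s hs
  exact hf.unique (hg.congr_of_eventuallyEq this)

/-- logarithmic derivatives of the metric functions -/
def om1 (d x y : ℝ) : ℝ := -2*d/(x^2-1) + 2*x*d^2/(x^2-1) - 2*x*(d^2-1)/(x^2-y^2)
def om2 (d x y : ℝ) : ℝ := 2*(d^2-1)*y/(x^2-y^2)
def lph (d x : ℝ) : ℝ := -2*d/(x^2-1)
def lv1 (d x : ℝ) : ℝ := 2*(d-x)/(x^2-1)
def lv2 (y : ℝ) : ℝ := 2*y/(1-y^2)

/-- the polynomial whose nonvanishing forces the Killing tensor to be trivial -/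
def Npol (d x y : ℝ) : ℝ :=
  9*x^2*d^2 + 12*x*y^2*d^3 + 6*x*y^2*d - 24*x*d^3 - 12*x*d
    - (8*d^4+11*d^2-1)*y^2 + 12*d^4 + 12*d^2 + 3

lemma om_ne {x y : ℝ} (hp : (x, y) ∈ Om) :
    x^2-1 ≠ 0 ∧ 1-y^2 ≠ 0 ∧ x^2-y^2 ≠ 0 ∧ y ≠ 0 := by
  obtain ⟨h1, h2, h3⟩ := hp
  simp only at h1 h2 h3
  refine ⟨?_, ?_, ?_, ?_⟩ <;> nlinarith

lemma alg1 (d x y a b c ay bx by' cx : ℝ) (hp : (x, y) ∈ Om)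
    (K2 : (2*x-om1 d x y*(x^2-1))*b/2 - (x^2-1)*bx - om2 d x y*(x^2-1)*c - (1-y^2)*ay = 0)
    (e2 : 2*(om2 d x y*a+ay)/(x^2-1)^2
      = ((lph d x + om1 d x y)*b + bx - 2*x*b/(x^2-1))/((x^2-1)*(1-y^2))) :
    3*(x^2-1)*(x^2-y^2)*bx = 4*(d^2-1)*y*(1-y^2)*(x^2-1)*(a/(x^2-1)-c/(1-y^2))
      + (6*d*(x^2-y^2)-4*(d^2-1)*x*(1-y^2))*b := by
  obtain ⟨hX, hY, hQ, hy⟩ := om_ne hp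
  have hay : ay = ((2*x-om1 d x y*(x^2-1))*b/2 - (x^2-1)*bx - om2 d x y*(x^2-1)*c)/(1-y^2) := by
    rw [eq_div_iff hY]; linear_combination -K2
  have e2' : 2*(om2 d x y*a+ay)*(1-y^2)
      = ((lph d x + om1 d x y)*b + bx - 2*x*b/(x^2-1))*(x^2-1) := by
    field_simp at e2 ⊢; linear_combination e2
  rw [hay] at e2'
  simp only [om1, om2, lph] at e2'
  field_simp at e2' ⊢
  linear_combination -e2'

lemma alg2 (d x y a b c ay bx by' cx : ℝ) (hp : (x, y) ∈ Om)
    (K2 : (2*x-om1 d x y*(x^2-1))*b/2 - (x^2-1)*bx - om2 d x y*(x^2-1)*c - (1-y^2)*ay = 0)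
    (K3 : -om1 d x y*(1-y^2)*a - (x^2-1)*cx + (-2*y-om2 d x y*(1-y^2))*b/2 - (1-y^2)*by' = 0)
    (hbx : 3*(x^2-1)*(x^2-y^2)*bx = 4*(d^2-1)*y*(1-y^2)*(x^2-1)*(a/(x^2-1)-c/(1-y^2))
      + (6*d*(x^2-y^2)-4*(d^2-1)*x*(1-y^2))*b)
    (e1 : ((lv2 y + om2 d x y)*(2*lv1 d x*a + lv2 y*b) + 2*lv1 d x*ay + lv2 y*by'
        + 2*(1+y^2)/(1-y^2)^2*b)/(x^2-1)
      = ((lv1 d x + om1 d x y)*(lv1 d x*b+2*lv2 y*c) + lv1 d x*bx + 2*lv2 y*cx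
        + 2*(1+x^2-2*d*x)/(x^2-1)^2*b)/(1-y^2)) :
    3*(x^2-1)*(1-y^2)*(x^2-y^2)*y*by' =
      -4*(d^2-1)*x*(1-y^2)*(x^2-1)*(1-y^2)*y*(a/(x^2-1)-c/(1-y^2))
      + (-6*x^4*y^2 + 6*d*x^3*y^2 - 6*d*x^3 + (4*d^2+2)*x^2*y^4 + (8-8*d^2)*x^2*y^2
        + (4*d^2+2)*x^2 - 6*d*x*y^4 + 6*d*x*y^2 - 6*y^2)*b := by
  obtain ⟨hX, hY, hQ, hy⟩ := om_ne hp
  have hay : ay = ((2*x-om1 d x y*(x^2-1))*b/2 - (x^2-1)*bx - om2 d x y*(x^2-1)*c)/(1-y^2) := by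
    rw [eq_div_iff hY]; linear_combination -K2
  have hcx : cx = (-om1 d x y*(1-y^2)*a + (-2*y-om2 d x y*(1-y^2))*b/2 - (1-y^2)*by')/(x^2-1) := by
    rw [eq_div_iff hX]; linear_combination -K3
  have hbx' : bx = (4*(d^2-1)*y*(1-y^2)*(x^2-1)*(a/(x^2-1)-c/(1-y^2))
      + (6*d*(x^2-y^2)-4*(d^2-1)*x*(1-y^2))*b)/(3*(x^2-1)*(x^2-y^2)) := by
    rw [← hbx]; field_simp
  have hby : 3*(2*y)*by' = 3*(x^2-1)*lv1 d x*(bx - x*b/(x^2-1)) - 6*y^2/(1-y^2)*b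
      + b*(2*((x^2-1)*om1 d x y*lv1 d x-(1-y^2)*om2 d x y*lv2 y)
        + (x^2-1)*((lv1 d x)^2-(2*(x^2-1)+4*x*(d-x))/(x^2-1)^2) + x*lv1 d x
        - (1-y^2)*((lv2 y)^2+2*(1+y^2)/(1-y^2)^2)+y*lv2 y)
      - 2*(a/(x^2-1)-c/(1-y^2))*(x^2-1)*(1-y^2)*(om2 d x y*lv1 d x+om1 d x y*lv2 y+lv1 d x*lv2 y) := by
    rw [hay, hcx] at e1
    simp only [lv1, lv2] at e1 ⊢
    generalize om1 d x y = W1 at *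
    generalize om2 d x y = W2 at *
    field_simp at e1 ⊢
    linear_combination 2*e1
  rw [hbx'] at hby
  simp only [lv1, lv2, om1, om2] at hby
  field_simp at hby ⊢
  linear_combination (1/2)*hby

lemma hasX2 (x : ℝ) : HasDerivAt (fun s : ℝ => s^2-1) (2*x) x := by
  simpa using (hasDerivAt_pow 2 x).sub_const 1

lemma hasY2 (y : ℝ) : HasDerivAt (fun s : ℝ => 1-s^2) (-(2*y)) y := by
  simpa using (hasDerivAt_pow 2 y).const_sub 1

lemma hasQx (x y : ℝ) : HasDerivAt (fun s : ℝ => s^2-y^2) (2*x) x := by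
  simpa using (hasDerivAt_pow 2 x).sub_const (y^2)

lemma hasQy (x y : ℝ) : HasDerivAt (fun s : ℝ => x^2-s^2) (-(2*y)) y := by
  simpa using (hasDerivAt_pow 2 y).const_sub (x^2)

lemma has_lv1 (d x : ℝ) (hX : x^2-1 ≠ 0) :
    HasDerivAt (fun s => lv1 d s) (2*(1+x^2-2*d*x)/(x^2-1)^2) x := by
  have := (((hasDerivAt_id x).const_sub d).const_mul 2).div (hasX2 x) hX
  unfold lv1
  refine this.congr_deriv ?_
  simp only [id]
  congr 1
  ring

lemma has_lv2 (y : ℝ) (hY : 1-y^2 ≠ 0) :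
    HasDerivAt (fun s => lv2 s) (2*(1+y^2)/(1-y^2)^2) y := by
  have := ((hasDerivAt_id y).const_mul 2).div (hasY2 y) hY
  unfold lv2
  refine this.congr_deriv ?_
  simp only [id]
  congr 1
  ring

lemma core_e2 (d : ℝ) (hd : d ≠ 0) (a b E2 T : ℝ → ℝ → ℝ)
    (ha : Sm a) (hb : Sm b) (hE : Sm E2)
    (T0 : ∀ x y, (x, y) ∈ Om → T x y ≠ 0)
    (TX : ∀ x y, (x, y) ∈ Om → HasDerivAt (fun s => T s y) (T x y*(lph d x+om1 d x y)) x)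
    (TY : ∀ x y, (x, y) ∈ Om → HasDerivAt (fun s => T x s) (T x y*om2 d x y) y)
    (Ex : ∀ x y, (x, y) ∈ Om → dX E2 x y = 2*d*T x y*a x y/(x^2-1)^2)
    (Ey : ∀ x y, (x, y) ∈ Om → dY E2 x y = d*T x y*b x y/((x^2-1)*(1-y^2)))
    (x y : ℝ) (hp : (x, y) ∈ Om) :
    2*(om2 d x y*a x y+dY a x y)/(x^2-1)^2
      = ((lph d x + om1 d x y)*b x y + dX b x y - 2*x*b x y/(x^2-1))/((x^2-1)*(1-y^2)) := by
  obtain ⟨hX, hY, hQ, hy⟩ := om_ne hp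
  have h1 := eqY Ex hp (hE.dX.hasY hp)
    ((((TY x y hp).const_mul (2*d)).mul (ha.hasY hp)).div_const _)
  have h2 := eqX Ey hp (hE.dY.hasX hp)
    ((((TX x y hp).const_mul d).mul (hb.hasX hp)).div ((hasX2 x).mul_const (1-y^2))
      (mul_ne_zero hX hY))
  have h3 := hE.symm hp
  rw [h1, h2] at h3
  have hT := T0 x y hp
  simp only [Pi.mul_apply] at h3
  generalize T x y = T at *
  field_simp at h3 ⊢
  linear_combination -h3

lemma core_e1 (d : ℝ) (a b c E1 R : ℝ → ℝ → ℝ)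
    (ha : Sm a) (hb : Sm b) (hc : Sm c) (hE : Sm E1)
    (R0 : ∀ x y, (x, y) ∈ Om → R x y ≠ 0)
    (RX : ∀ x y, (x, y) ∈ Om → HasDerivAt (fun s => R s y) (R x y*(lv1 d x+om1 d x y)) x)
    (RY : ∀ x y, (x, y) ∈ Om → HasDerivAt (fun s => R x s) (R x y*(lv2 y+om2 d x y)) y)
    (Ex : ∀ x y, (x, y) ∈ Om →
      dX E1 x y = R x y*(2*lv1 d x*a x y+lv2 y*b x y)/(2*(x^2-1)))
    (Ey : ∀ x y, (x, y) ∈ Om →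
      dY E1 x y = R x y*(lv1 d x*b x y+2*lv2 y*c x y)/(2*(1-y^2)))
    (x y : ℝ) (hp : (x, y) ∈ Om) :
    ((lv2 y + om2 d x y)*(2*lv1 d x*a x y + lv2 y*b x y) + 2*lv1 d x*dY a x y + lv2 y*dY b x y
        + 2*(1+y^2)/(1-y^2)^2*b x y)/(x^2-1)
      = ((lv1 d x + om1 d x y)*(lv1 d x*b x y+2*lv2 y*c x y) + lv1 d x*dX b x y
        + 2*lv2 y*dX c x y + 2*(1+x^2-2*d*x)/(x^2-1)^2*b x y)/(1-y^2) := by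
  obtain ⟨hX, hY, hQ, hy⟩ := om_ne hp
  have h1 := eqY Ex hp (hE.dX.hasY hp)
    (((RY x y hp).mul (((ha.hasY hp).const_mul (2*lv1 d x)).add
      ((has_lv2 y hY).mul (hb.hasY hp)))).div_const (2*(x^2-1)))
  have h2 := eqX Ey hp (hE.dY.hasX hp)
    (((RX x y hp).mul (((has_lv1 d x hX).mul (hb.hasX hp)).add
      ((hc.hasX hp).const_mul (2*lv2 y)))).div_const (2*(1-y^2)))
  have h3 := hE.symm hp
  rw [h1, h2] at h3
  have hR := R0 x y hp
  generalize R x y = R at *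
  simp only [Pi.add_apply, Pi.mul_apply] at h3
  generalize 2*(1+y^2)/(1-y^2)^2 = A1 at *
  generalize 2*(1+x^2-2*d*x)/(x^2-1)^2 = A2 at *
  field_simp at h3 ⊢
  linear_combination -h3

set_option maxHeartbeats 4000000 in
lemma alg_fin (d x y b D bx by' Dx Dy bxy Dxy : ℝ)
    (hX : x^2-1 ≠ 0) (hY : 1-y^2 ≠ 0) (hQ : x^2-y^2 ≠ 0) (hy : y ≠ 0) (hd : d^2-1 ≠ 0)
    (hN : Npol d x y ≠ 0)
    (vbx : 3*(x^2-1)*(x^2-y^2)*bx = 4*(d^2-1)*y*(1-y^2)*(x^2-1)*D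
      + (6*d*(x^2-y^2)-4*(d^2-1)*x*(1-y^2))*b)
    (vby : 3*(x^2-1)*(1-y^2)*(x^2-y^2)*y*by' = -4*(d^2-1)*x*(1-y^2)*(x^2-1)*(1-y^2)*y*D
      + (-6*x^4*y^2 + 6*d*x^3*y^2 - 6*d*x^3 + (4*d^2+2)*x^2*y^4 + (8-8*d^2)*x^2*y^2 + (4*d^2+2)*x^2 - 6*d*x*y^4 + 6*d*x*y^2 - 6*y^2)*b)
    (vDx : 3*(x^2-1)^2*(1-y^2)*(x^2-y^2)*y*Dx = -4*(d^2-1)*x*(1-y^2)*(x^2-1)*(1-y^2)*y*D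
      + (-6*x^4*y^2 + 6*d*x^3*y^2 - 6*d*x^3 + (4*d^2+2)*x^2*y^4 + (8-8*d^2)*x^2*y^2 + (4*d^2+2)*x^2 - 6*d*x*y^4 + 6*d*x*y^2 - 6*y^2
        + 3*(x^2-1)*(x^2-y^2)*y^2)*b)
    (vDy : 3*(x^2-1)*(1-y^2)*(x^2-y^2)*Dy = -4*(d^2-1)*y*(1-y^2)*(x^2-1)*D
      + (-6*d*(x^2-y^2)+4*(d^2-1)*x*(1-y^2)+3*(x^2-y^2)*x)*b)
    (pbx : 3*(x^2-1)*-(2*y)*bx + 3*(x^2-1)*(x^2-y^2)*bxy =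
      (4*(d^2-1)*1*(1-y^2)+4*(d^2-1)*y*-(2*y))*(x^2-1)*D + 4*(d^2-1)*y*(1-y^2)*(x^2-1)*Dy
      + ((6*d*-(2*y)-4*(d^2-1)*x*-(2*y))*b + (6*d*(x^2-y^2)-4*(d^2-1)*x*(1-y^2))*by'))
    (pby : (3*(2*x)*(1-y^2)*(x^2-y^2)+3*(x^2-1)*(1-y^2)*(2*x))*y*by' + 3*(x^2-1)*(1-y^2)*(x^2-y^2)*y*bxy =
      (-4*(d^2-1)*1*(1-y^2)*(x^2-1) + -4*(d^2-1)*x*(1-y^2)*(2*x))*(1-y^2)*y*D + -4*(d^2-1)*x*(1-y^2)*(x^2-1)*(1-y^2)*y*Dx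
      + ((-24*x^3*y^2 + 18*d*x^2*y^2 - 18*d*x^2 + 2*(4*d^2+2)*x*y^4
        + 2*(8-8*d^2)*x*y^2 + 2*(4*d^2+2)*x - 6*d*y^4 + 6*d*y^2)*b
        + (-6*x^4*y^2 + 6*d*x^3*y^2 - 6*d*x^3 + (4*d^2+2)*x^2*y^4 + (8-8*d^2)*x^2*y^2 + (4*d^2+2)*x^2 - 6*d*x*y^4 + 6*d*x*y^2 - 6*y^2)*bx))
    (pDx : ((3*(x^2-1)^2*-(2*y)*(x^2-y^2) + 3*(x^2-1)^2*(1-y^2)*-(2*y))*y + 3*(x^2-1)^2*(1-y^2)*(x^2-y^2)*1)*Dx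
        + 3*(x^2-1)^2*(1-y^2)*(x^2-y^2)*y*Dxy =
      ((-4*(d^2-1)*x*-(2*y)*(x^2-1)*(1-y^2) + -4*(d^2-1)*x*(1-y^2)*(x^2-1)*-(2*y))*y + -4*(d^2-1)*x*(1-y^2)*(x^2-1)*(1-y^2)*1)*D
      + -4*(d^2-1)*x*(1-y^2)*(x^2-1)*(1-y^2)*y*Dy
      + ((-12*x^4*y + 12*d*x^3*y + 4*(4*d^2+2)*x^2*y^3
        + 2*(8-8*d^2)*x^2*y - 24*d*x*y^3 + 12*d*x*y - 12*y + 3*(x^2-1)*(2*x^2*y-4*y^3))*b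
        + (-6*x^4*y^2 + 6*d*x^3*y^2 - 6*d*x^3 + (4*d^2+2)*x^2*y^4 + (8-8*d^2)*x^2*y^2 + (4*d^2+2)*x^2 - 6*d*x*y^4 + 6*d*x*y^2 - 6*y^2 + 3*(x^2-1)*(x^2-y^2)*y^2)*by'))
    (pDy : (3*(2*x)*(1-y^2)*(x^2-y^2) + 3*(x^2-1)*(1-y^2)*(2*x))*Dy + 3*(x^2-1)*(1-y^2)*(x^2-y^2)*Dxy =
      -4*(d^2-1)*y*(1-y^2)*(2*x)*D + -4*(d^2-1)*y*(1-y^2)*(x^2-1)*Dx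
      + ((-6*d*(2*x) + 4*(d^2-1)*1*(1-y^2) + (3*(2*x)*x + 3*(x^2-y^2)*1))*b
        + (-6*d*(x^2-y^2)+4*(d^2-1)*x*(1-y^2)+3*(x^2-y^2)*x)*bx)) :
    D = 0 ∧ b = 0 := by
  have q1 : (-8*(d^2-1)*(2*d^2+1)*(1-y^2)*(x^2-1)*y)*D + (-18*x^4*d + 24*x^3*d^2 + 12*x^3 + 18*x^2*y^2*d - 24*x^2*d^3 + 6*x^2*d - 16*x*y^2*d^4 - 16*x*y^2*d^2 - 4*x*y^2 + 16*x*d^4 - 8*x*d^2 - 8*x + 24*y^2*d^3 - 6*y^2*d)*b = 0 := by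
    have h : (x^2-1)*(1-y^2)^2*(x^2-y^2)*y ≠ 0 := by simp [hX, hY, hQ, hy]
    refine (mul_eq_zero.1 ?_).resolve_left h
    linear_combination
      -(3*(x^2-1)^2*(1-y^2)*(x^2-y^2)*y)*((1-y^2)*y*pbx - pby)
      + ((1-y^2)*y*(-6*(x^2-1)*y) + (-6*x^4*y^2 + 6*d*x^3*y^2 - 6*d*x^3 + (4*d^2+2)*x^2*y^4 + (8-8*d^2)*x^2*y^2 + (4*d^2+2)*x^2 - 6*d*x*y^4 + 6*d*x*y^2 - 6*y^2))*(x^2-1)*(1-y^2)*y*vbx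
      + ((1-y^2)*y*(-(6*d*(x^2-y^2)-4*(d^2-1)*x*(1-y^2))) - (6*x*(1-y^2)*(x^2-y^2)+6*x*(x^2-1)*(1-y^2))*y)*(x^2-1)*vby
      + (-(4*(d^2-1)*x*(1-y^2)*(x^2-1)*(1-y^2)*y))*vDx
      + (-(1-y^2)*y*4*(d^2-1)*y*(1-y^2)*(x^2-1))*(x^2-1)*y*vDy
  have q2 : ((d^2-1)*(24*x^2*d + 16*x*y^2*d^2+8*x*y^2 - 16*x*d^2 - 8*x - 24*y^2*d)*(x^2-1)*(1-y^2)*y)*D + (-18*x^5*y^2*d+18*x^5*d-18*x^4*y^2+24*x^4*d^2-6*x^4+18*x^3*y^4*d+48*x^3*y^2*d^3+24*x^3*y^2*d-48*x^3*d^3-42*x^3*d+16*x^2*y^4*d^4-8*x^2*y^4*d^2+10*x^2*y^4-32*x^2*y^2*d^4-68*x^2*y^2*d^2+28*x^2*y^2+16*x^2*d^4+28*x^2*d^2+10*x^2-48*x*y^4*d^3-42*x*y^4*d+48*x*y^2*d^3+42*x*y^2*d+60*y^4*d^2-6*y^4-36*y^2*d^2-18*y^2)*b = 0 := by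
    have h : (x^2-1)*(1-y^2)*(x^2-y^2) ≠ 0 := by simp [hX, hY, hQ]
    refine (mul_eq_zero.1 ?_).resolve_left h
    linear_combination
      -(3*(x^2-1)^2*(1-y^2)*(x^2-y^2)*y)*(pDx - (x^2-1)*y*pDy)
      + ((x^2-1)*y*(-6*d*(x^2-y^2)+4*(d^2-1)*x*(1-y^2)+3*(x^2-y^2)*x))*(x^2-1)*(1-y^2)*y*vbx
      - ((-6*x^4*y^2 + 6*d*x^3*y^2 - 6*d*x^3 + (4*d^2+2)*x^2*y^4 + (8-8*d^2)*x^2*y^2 + (4*d^2+2)*x^2 - 6*d*x*y^4 + 6*d*x*y^2 - 6*y^2) + 3*(x^2-1)*(x^2-y^2)*y^2)*(x^2-1)*vby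
      + ((-6*(x^2-1)^2*y*(x^2-y^2)-6*(x^2-1)^2*(1-y^2)*y)*y+3*(x^2-1)^2*(1-y^2)*(x^2-y^2) - (x^2-1)*y*(4*(d^2-1)*y*(1-y^2)*(x^2-1)))*vDx
      + (4*(d^2-1)*x*(1-y^2)*(x^2-1)*(1-y^2)*y - (x^2-1)*y*(6*x*(1-y^2)*(x^2-y^2)+6*x*(x^2-1)*(1-y^2)))*(x^2-1)*y*vDy
  have hdet : (d^2-1)*Npol d x y*(x^2-1)^2*(1-y^2)*(x^2-y^2)*y ≠ 0 := by simp [hX, hY, hQ, hy, hd, hN]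
  constructor
  · refine (mul_eq_zero.1 ?_).resolve_left hdet
    unfold Npol
    linear_combination (1/48)*(-18*x^5*y^2*d+18*x^5*d-18*x^4*y^2+24*x^4*d^2-6*x^4+18*x^3*y^4*d+48*x^3*y^2*d^3+24*x^3*y^2*d-48*x^3*d^3-42*x^3*d+16*x^2*y^4*d^4-8*x^2*y^4*d^2+10*x^2*y^4-32*x^2*y^2*d^4-68*x^2*y^2*d^2+28*x^2*y^2+16*x^2*d^4+28*x^2*d^2+10*x^2-48*x*y^4*d^3-42*x*y^4*d+48*x*y^2*d^3+42*x*y^2*d+60*y^4*d^2-6*y^4-36*y^2*d^2-18*y^2)*q1 - (1/48)*(-18*x^4*d + 24*x^3*d^2 + 12*x^3 + 18*x^2*y^2*d - 24*x^2*d^3 + 6*x^2*d - 16*x*y^2*d^4 - 16*x*y^2*d^2 - 4*x*y^2 + 16*x*d^4 - 8*x*d^2 - 8*x + 24*y^2*d^3 - 6*y^2*d)*q2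
  · refine (mul_eq_zero.1 ?_).resolve_left hdet
    unfold Npol
    linear_combination (1/48)*(-8*(d^2-1)*(2*d^2+1)*(1-y^2)*(x^2-1)*y)*q2 - (1/48)*((d^2-1)*(24*x^2*d + 16*x*y^2*d^2+8*x*y^2 - 16*x*d^2 - 8*x - 24*y^2*d)*(x^2-1)*(1-y^2)*y)*q1

lemma core_fin (d : ℝ) (b D : ℝ → ℝ → ℝ) (hb : Sm b) (hD : Sm D)
    (bx : ∀ x y, (x, y) ∈ Om → 3*(x^2-1)*(x^2-y^2)*dX b x y
      = 4*(d^2-1)*y*(1-y^2)*(x^2-1)*D x y + (6*d*(x^2-y^2)-4*(d^2-1)*x*(1-y^2))*b x y)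
    (by' : ∀ x y, (x, y) ∈ Om → 3*(x^2-1)*(1-y^2)*(x^2-y^2)*y*dY b x y =
      -4*(d^2-1)*x*(1-y^2)*(x^2-1)*(1-y^2)*y*D x y
      + (-6*x^4*y^2 + 6*d*x^3*y^2 - 6*d*x^3 + (4*d^2+2)*x^2*y^4 + (8-8*d^2)*x^2*y^2
        + (4*d^2+2)*x^2 - 6*d*x*y^4 + 6*d*x*y^2 - 6*y^2)*b x y)
    (Dx : ∀ x y, (x, y) ∈ Om → (x^2-1)*(1-y^2)*dX D x y = (1-y^2)*dY b x y + y*b x y)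
    (Dy : ∀ x y, (x, y) ∈ Om → (x^2-1)*(1-y^2)*dY D x y = -(x^2-1)*dX b x y + x*b x y)
    (hd : d^2-1 ≠ 0) (x y : ℝ) (hp : (x, y) ∈ Om) (hN : Npol d x y ≠ 0) :
    D x y = 0 ∧ b x y = 0 := by
  obtain ⟨hX, hY, hQ, hy⟩ := om_ne hp
  have sb := hb.symm hp
  have sD := hD.symm hp
  -- differentiate the relations
  have pbx := eqY bx hp
    ((((hasQy x y).const_mul (3*(x^2-1))).mul (hb.dX.hasY hp)))
    ((((((hasDerivAt_id y).const_mul (4*(d^2-1))).mul (hasY2 y)).mul_const (x^2-1)).mul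
      (hD.hasY hp)).add ((((hasQy x y).const_mul (6*d)).sub
        ((hasY2 y).const_mul (4*(d^2-1)*x))).mul (hb.hasY hp)))
  have pP : HasDerivAt (fun s : ℝ => -6*s^4*y^2 + 6*d*s^3*y^2 - 6*d*s^3 + (4*d^2+2)*s^2*y^4
        + (8-8*d^2)*s^2*y^2
        + (4*d^2+2)*s^2 - 6*d*s*y^4 + 6*d*s*y^2 - 6*y^2)
      (-24*x^3*y^2 + 18*d*x^2*y^2 - 18*d*x^2 + 2*(4*d^2+2)*x*y^4
        + 2*(8-8*d^2)*x*y^2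
        + 2*(4*d^2+2)*x - 6*d*y^4 + 6*d*y^2) x := by
    have h4 := hasDerivAt_pow 4 x
    have h3 := hasDerivAt_pow 3 x
    have h2 := hasDerivAt_pow 2 x
    have h1 := hasDerivAt_id x
    have := ((((((((h4.const_mul (-6)).mul_const (y^2)).add ((h3.const_mul (6*d)).mul_const (y^2))).sub
      (h3.const_mul (6*d))).add ((h2.const_mul (4*d^2+2)).mul_const (y^4))).add
      ((h2.const_mul (8-8*d^2)).mul_const (y^2))).add (h2.const_mul (4*d^2+2))).sub
      ((h1.const_mul (6*d)).mul_const (y^4))).add ((h1.const_mul (6*d)).mul_const (y^2))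
    refine (this.sub_const (6*y^2)).congr_deriv ?_
    norm_num
    ring
  have pby := eqX by' hp
    ((((((hasX2 x).const_mul 3).mul_const (1-y^2)).mul (hasQx x y)).mul_const y).mul (hb.dY.hasX hp))
    (((((((hasDerivAt_id x).const_mul (-4*(d^2-1))).mul_const (1-y^2)).mul (hasX2 x)).mul_const
      (1-y^2)).mul_const y).mul (hD.hasX hp) |>.add (pP.mul (hb.hasX hp)))
  have Dx2 : ∀ x y, (x, y) ∈ Om → 3*(x^2-1)^2*(1-y^2)*(x^2-y^2)*y*dX D x y =
      -4*(d^2-1)*x*(1-y^2)*(x^2-1)*(1-y^2)*y*D x y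
      + (-6*x^4*y^2 + 6*d*x^3*y^2 - 6*d*x^3 + (4*d^2+2)*x^2*y^4 + (8-8*d^2)*x^2*y^2
        + (4*d^2+2)*x^2 - 6*d*x*y^4 + 6*d*x*y^2 - 6*y^2 + 3*(x^2-1)*(x^2-y^2)*y^2)*b x y := by
    intro x y hp
    linear_combination 3*(x^2-1)*(x^2-y^2)*y*Dx x y hp + by' x y hp
  have Dy2 : ∀ x y, (x, y) ∈ Om → 3*(x^2-1)*(1-y^2)*(x^2-y^2)*dY D x y =
      -4*(d^2-1)*y*(1-y^2)*(x^2-1)*D x y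
      + (-6*d*(x^2-y^2)+4*(d^2-1)*x*(1-y^2) + 3*(x^2-y^2)*x)*b x y := by
    intro x y hp
    linear_combination 3*(x^2-y^2)*Dy x y hp - bx x y hp
  have pP2 : HasDerivAt (fun s : ℝ => -6*x^4*s^2 + 6*d*x^3*s^2 - 6*d*x^3 + (4*d^2+2)*x^2*s^4
        + (8-8*d^2)*x^2*s^2
        + (4*d^2+2)*x^2 - 6*d*x*s^4 + 6*d*x*s^2 - 6*s^2 + 3*(x^2-1)*(x^2-s^2)*s^2)
      (-12*x^4*y + 12*d*x^3*y + 4*(4*d^2+2)*x^2*y^3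
        + 2*(8-8*d^2)*x^2*y - 24*d*x*y^3 + 12*d*x*y - 12*y
        + 3*(x^2-1)*(2*x^2*y-4*y^3)) y := by
    have h4 := hasDerivAt_pow 4 y
    have h2 := hasDerivAt_pow 2 y
    have := (((((((((h2.const_mul (-6*x^4)).add (h2.const_mul (6*d*x^3))).sub_const (6*d*x^3)).add
      (h4.const_mul ((4*d^2+2)*x^2))).add (h2.const_mul ((8-8*d^2)*x^2))).add_const
      ((4*d^2+2)*x^2)).sub (h4.const_mul (6*d*x))).add (h2.const_mul (6*d*x))).sub
      (h2.const_mul 6)).add (((hasQy x y).const_mul (3*(x^2-1))).mul h2)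
    refine this.congr_deriv ?_
    norm_num
    ring
  have pDx := eqY Dx2 hp
    ((((((hasY2 y).const_mul (3*(x^2-1)^2)).mul (hasQy x y)).mul (hasDerivAt_id y))).mul (hD.dX.hasY hp))
    ((((((hasY2 y).const_mul (-4*(d^2-1)*x)).mul_const (x^2-1)).mul (hasY2 y)).mul
      (hasDerivAt_id y)).mul (hD.hasY hp) |>.add (pP2.mul (hb.hasY hp)))
  have pDy := eqX Dy2 hp
    (((((hasX2 x).const_mul 3).mul_const (1-y^2)).mul (hasQx x y)).mul (hD.dY.hasX hp))
    ((((hasX2 x).const_mul (-4*(d^2-1)*y*(1-y^2))).mul (hD.hasX hp)).add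
      ((((hasQx x y).const_mul (-6*d)).add (((hasDerivAt_id x).const_mul (4*(d^2-1))).mul_const
        (1-y^2)) |>.add (((hasQx x y).const_mul 3).mul (hasDerivAt_id x))).mul (hb.hasX hp)))
  have vbx := bx x y hp
  have vby := by' x y hp
  have vDx := Dx2 x y hp
  have vDy := Dy2 x y hp
  simp only [Pi.add_apply, Pi.mul_apply, Pi.sub_apply, id] at pbx pby pDx pDy
  rw [sb] at pby
  rw [sD] at pDy
  clear sb sD bx by' Dx Dy Dx2 Dy2 pP pP2 hb hD
  generalize dY (dX b) x y = bxy at *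
  generalize dY (dX D) x y = Dxy at *
  generalize dX b x y = bx at *
  generalize dY b x y = by' at *
  generalize dX D x y = Dx at *
  generalize dY D x y = Dy at *
  generalize D x y = D at *
  generalize b x y = b at *
  exact alg_fin d x y b D bx by' Dx Dy bxy Dxy hX hY hQ hy hd hN vbx vby vDx vDy pbx pby pDx pDy

lemma Sm.mkD {a c : ℝ → ℝ → ℝ} (ha : Sm a) (hc : Sm c) :
    Sm (fun x y => a x y/(x^2-1) - c x y/(1-y^2)) := by
  unfold Sm at *
  refine ContDiffOn.sub (ha.div (by fun_prop) ?_) (hc.div (by fun_prop) ?_)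
  · intro p hp; exact (om_ne (x := p.1) (y := p.2) hp).1
  · intro p hp; exact (om_ne (x := p.1) (y := p.2) hp).2.1

lemma core (d : ℝ) (hd : d ≠ 0) (hd1 : d^2-1 ≠ 0) (a b c E1 E2 T R : ℝ → ℝ → ℝ)
    (ha : Sm a) (hb : Sm b) (hc : Sm c) (hE1 : Sm E1) (hE2 : Sm E2)
    (T0 : ∀ x y, (x, y) ∈ Om → T x y ≠ 0)
    (TX : ∀ x y, (x, y) ∈ Om → HasDerivAt (fun s => T s y) (T x y*(lph d x+om1 d x y)) x)
    (TY : ∀ x y, (x, y) ∈ Om → HasDerivAt (fun s => T x s) (T x y*om2 d x y) y)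
    (R0 : ∀ x y, (x, y) ∈ Om → R x y ≠ 0)
    (RX : ∀ x y, (x, y) ∈ Om → HasDerivAt (fun s => R s y) (R x y*(lv1 d x+om1 d x y)) x)
    (RY : ∀ x y, (x, y) ∈ Om → HasDerivAt (fun s => R x s) (R x y*(lv2 y+om2 d x y)) y)
    (K1 : ∀ x y, (x, y) ∈ Om → (2*x-om1 d x y*(x^2-1))*a x y - (x^2-1)*dX a x y
      - om2 d x y*(x^2-1)*b x y/2 = 0)
    (K2 : ∀ x y, (x, y) ∈ Om → (2*x-om1 d x y*(x^2-1))*b x y/2 - (x^2-1)*dX b x y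
      - om2 d x y*(x^2-1)*c x y - (1-y^2)*dY a x y = 0)
    (K3 : ∀ x y, (x, y) ∈ Om → -om1 d x y*(1-y^2)*a x y - (x^2-1)*dX c x y
      + (-2*y-om2 d x y*(1-y^2))*b x y/2 - (1-y^2)*dY b x y = 0)
    (K4 : ∀ x y, (x, y) ∈ Om → -om1 d x y*(1-y^2)*b x y/2
      + (-2*y-om2 d x y*(1-y^2))*c x y - (1-y^2)*dY c x y = 0)
    (E2x : ∀ x y, (x, y) ∈ Om → dX E2 x y = 2*d*T x y*a x y/(x^2-1)^2)
    (E2y : ∀ x y, (x, y) ∈ Om → dY E2 x y = d*T x y*b x y/((x^2-1)*(1-y^2)))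
    (E1x : ∀ x y, (x, y) ∈ Om →
      dX E1 x y = R x y*(2*lv1 d x*a x y+lv2 y*b x y)/(2*(x^2-1)))
    (E1y : ∀ x y, (x, y) ∈ Om →
      dY E1 x y = R x y*(lv1 d x*b x y+2*lv2 y*c x y)/(2*(1-y^2)))
    (x y : ℝ) (hp : (x, y) ∈ Om) (hN : Npol d x y ≠ 0) :
    (1-y^2)*a x y = (x^2-1)*c x y ∧ b x y = 0 ∧ dX b x y = 0 ∧ dY b x y = 0 := by
  have bx : ∀ x y, (x, y) ∈ Om → _ := fun x y hp =>
    alg1 d x y (a x y) (b x y) (c x y) (dY a x y) (dX b x y) (dY b x y) (dX c x y) hp (K2 x y hp)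
      (core_e2 d hd a b E2 T ha hb hE2 T0 TX TY E2x E2y x y hp)
  have by' : ∀ x y, (x, y) ∈ Om → _ := fun x y hp =>
    alg2 d x y (a x y) (b x y) (c x y) (dY a x y) (dX b x y) (dY b x y) (dX c x y) hp (K2 x y hp)
      (K3 x y hp) (bx x y hp) (core_e1 d a b c E1 R ha hb hc hE1 R0 RX RY E1x E1y x y hp)
  have hD := Sm.mkD ha hc
  have key := core_fin d b (fun x y => a x y/(x^2-1) - c x y/(1-y^2)) hb hD bx by'
    (by
      intro x y hp
      obtain ⟨hX, hY, hQ, hy⟩ := om_ne hp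
      have h := (hD.hasX hp).unique
        (((ha.hasX hp).div (hasX2 x) hX).sub ((hc.hasX hp).div_const (1-y^2)))
      rw [h]
      have k1 := K1 x y hp
      have k3 := K3 x y hp
      have e : dX a x y = ((2*x-om1 d x y*(x^2-1))*a x y
        - om2 d x y*(x^2-1)*b x y/2)/(x^2-1) := by
        rw [eq_div_iff hX]; linear_combination -k1
      have e' : dX c x y = (-om1 d x y*(1-y^2)*a x y
        + (-2*y-om2 d x y*(1-y^2))*b x y/2 - (1-y^2)*dY b x y)/(x^2-1) := by
        rw [eq_div_iff hX]; linear_combination -k3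
      rw [e, e']
      field_simp
      ring)
    (by
      intro x y hp
      obtain ⟨hX, hY, hQ, hy⟩ := om_ne hp
      have h := (hD.hasY hp).unique
        (((ha.hasY hp).div_const (x^2-1)).sub ((hc.hasY hp).div (hasY2 y) hY))
      rw [h]
      have k1 := K2 x y hp
      have k3 := K4 x y hp
      have e : dY a x y = ((2*x-om1 d x y*(x^2-1))*b x y/2 - (x^2-1)*dX b x y
      - om2 d x y*(x^2-1)*c x y)/(1-y^2) := by
        rw [eq_div_iff hY]; linear_combination -k1
      have e' : dY c x y = (-om1 d x y*(1-y^2)*b x y/2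
      + (-2*y-om2 d x y*(1-y^2))*c x y)/(1-y^2) := by
        rw [eq_div_iff hY]; linear_combination -k3
      rw [e, e']
      field_simp
      ring)
    hd1 x y hp hN
  obtain ⟨hX, hY, hQ, hy⟩ := om_ne hp
  obtain ⟨h1, h2⟩ := key
  have b1 := bx x y hp
  have b2 := by' x y hp
  rw [h1, h2] at b1 b2
  simp [hX, hY, hQ, hy] at b1 b2
  refine ⟨?_, h2, b1, b2⟩
  field_simp at h1
  linear_combination h1

/-- extraction of coefficients of the bracket -/
lemma extract (x y X Y w o1 o2 h v1 v2 F ph a ax ay b bx b' c cx cy u6 u6x u6y v6 v6x v6y u7 u7x u7y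
    v7 v7x v7y u0 u0x u0y v0 v0x v0y e66x e66y e67x e67y e77x e77y e6x e6y e7x e7y e0x e0y : ℝ)
    (hw : w ≠ 0) (hh : h ≠ 0) (hF : F ≠ 0) (hph : ph ≠ 0) (hv2 : v2 ≠ 0) (hX : X ≠ 0) (hY : Y ≠ 0)
    (E : ∀ p q r s : ℝ,
      (1/2)*(2*x*p^2*w - o1*w*(X*p^2+Y*q^2) + h*v1*r^2 - F*ph*s^2)
        * (2*a*p+b*q+u6*r+u7*s+u0)
      - X*p*w*(ax*p^2+bx*(p*q)+cx*q^2+u6x*(p*r)+v6x*(q*r)+u7x*(p*s)+v7x*(q*s)+u0x*p+v0x*q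
          +e66x*r^2+e67x*(r*s)+e77x*s^2+e6x*r+e7x*s+e0x)
      + (1/2)*(-2*y*q^2*w - o2*w*(X*p^2+Y*q^2) + h*v2*r^2)
        * (b*p+2*c*q+v6*r+v7*s+v0)
      - Y*q*w*(ay*p^2+b'*(p*q)+cy*q^2+u6y*(p*r)+v6y*(q*r)+u7y*(p*s)+v7y*(q*s)+u0y*p+v0y*q
          +e66y*r^2+e67y*(r*s)+e77y*s^2+e6y*r+e7y*s+e0y) = 0) :
    ((2*x-o1*X)*a - X*ax - o2*X*b/2 = 0 ∧
     (2*x-o1*X)*b/2 - X*bx - o2*X*c - Y*ay = 0 ∧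
     -o1*Y*a - X*cx + (-2*y-o2*Y)*b/2 - Y*b' = 0 ∧
     -o1*Y*b/2 + (-2*y-o2*Y)*c - Y*cy = 0) ∧
    (-F*ph*a = X*w*e77x ∧ -F*ph*b = 2*Y*w*e77y ∧ h*(2*v1*a+v2*b) = 2*X*w*e66x ∧
     h*(v1*b+2*v2*c) = 2*Y*w*e66y) ∧
    (e67x = 0 ∧ e67y = 0 ∧ e6x = 0 ∧ e6y = 0 ∧ e7x = 0 ∧ e7y = 0 ∧ e0x = 0 ∧ e0y = 0) ∧
    (u6 = 0 ∧ v6 = 0 ∧ u7 = 0 ∧ v7 = 0 ∧ u0 = 0 ∧ v0 = 0) := by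
  refine ⟨⟨?_, ?_, ?_, ?_⟩, ⟨?_, ?_, ?_, ?_⟩, ⟨?_, ?_, ?_, ?_, ?_, ?_, ?_, ?_⟩, ?_⟩
  · refine (mul_eq_zero.1 ?_).resolve_left hw
    linear_combination (1/12)*(E 2 0 0 0 - E (-2) 0 0 0 - 2*(E 1 0 0 0 - E (-1) 0 0 0))
  · refine (mul_eq_zero.1 ?_).resolve_left hw
    linear_combination (1/2)*(E 1 1 0 0 + E (-1) 1 0 0 - 2*E 0 1 0 0
      - (E 1 0 0 0 + E (-1) 0 0 0 - 2*E 0 0 0 0))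
  · refine (mul_eq_zero.1 ?_).resolve_left hw
    linear_combination (1/2)*(E 1 1 0 0 + E 1 (-1) 0 0 - 2*E 1 0 0 0
      - (E 0 1 0 0 + E 0 (-1) 0 0 - 2*E 0 0 0 0))
  · refine (mul_eq_zero.1 ?_).resolve_left hw
    linear_combination (1/12)*(E 0 2 0 0 - E 0 (-2) 0 0 - 2*(E 0 1 0 0 - E 0 (-1) 0 0))
  · linear_combination (1/2)*(E 1 0 0 1 + E 1 0 0 (-1) - 2*E 1 0 0 0
      - (E 0 0 0 1 + E 0 0 0 (-1) - 2*E 0 0 0 0))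
  · linear_combination (E 0 1 0 1 + E 0 1 0 (-1) - 2*E 0 1 0 0
      - (E 0 0 0 1 + E 0 0 0 (-1) - 2*E 0 0 0 0))
  · linear_combination (E 1 0 1 0 + E 1 0 (-1) 0 - 2*E 1 0 0 0
      - (E 0 0 1 0 + E 0 0 (-1) 0 - 2*E 0 0 0 0))
  · linear_combination (E 0 1 1 0 + E 0 1 (-1) 0 - 2*E 0 1 0 0
      - (E 0 0 1 0 + E 0 0 (-1) 0 - 2*E 0 0 0 0))
  · refine (mul_eq_zero.1 ?_).resolve_left (mul_ne_zero hX hw)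
    linear_combination (-1/8)*(E 1 0 1 1 - E (-1) 0 1 1 - E 1 0 (-1) 1 - E 1 0 1 (-1)
      + E (-1) 0 (-1) 1 + E (-1) 0 1 (-1) + E 1 0 (-1) (-1) - E (-1) 0 (-1) (-1))
  · refine (mul_eq_zero.1 ?_).resolve_left (mul_ne_zero hY hw)
    linear_combination (-1/8)*(E 0 1 1 1 - E 0 (-1) 1 1 - E 0 1 (-1) 1 - E 0 1 1 (-1)
      + E 0 (-1) (-1) 1 + E 0 (-1) 1 (-1) + E 0 1 (-1) (-1) - E 0 (-1) (-1) (-1))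
  · refine (mul_eq_zero.1 ?_).resolve_left (mul_ne_zero hX hw)
    linear_combination (-1/4)*(E 1 0 1 0 - E (-1) 0 1 0 - E 1 0 (-1) 0 + E (-1) 0 (-1) 0)
  · refine (mul_eq_zero.1 ?_).resolve_left (mul_ne_zero hY hw)
    linear_combination (-1/4)*(E 0 1 1 0 - E 0 (-1) 1 0 - E 0 1 (-1) 0 + E 0 (-1) (-1) 0)
  · refine (mul_eq_zero.1 ?_).resolve_left (mul_ne_zero hX hw)
    linear_combination (-1/4)*(E 1 0 0 1 - E (-1) 0 0 1 - E 1 0 0 (-1) + E (-1) 0 0 (-1))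
  · refine (mul_eq_zero.1 ?_).resolve_left (mul_ne_zero hY hw)
    linear_combination (-1/4)*(E 0 1 0 1 - E 0 (-1) 0 1 - E 0 1 0 (-1) + E 0 (-1) 0 (-1))
  · refine (mul_eq_zero.1 ?_).resolve_left (mul_ne_zero hX hw)
    linear_combination (-1/12)*(8*(E 1 0 0 0 - E (-1) 0 0 0) - (E 2 0 0 0 - E (-2) 0 0 0))
  · refine (mul_eq_zero.1 ?_).resolve_left (mul_ne_zero hY hw)
    linear_combination (-1/12)*(8*(E 0 1 0 0 - E 0 (-1) 0 0) - (E 0 2 0 0 - E 0 (-2) 0 0))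
  · have hFp := mul_ne_zero hF hph
    have hhv := mul_ne_zero hh hv2
    have u6z : u6 = 0 := by
      refine (mul_eq_zero.1 ?_).resolve_left hFp
      linear_combination -(E 0 0 1 1 + E 0 0 1 (-1) - 2*E 0 0 1 0
        - (E 0 0 0 1 + E 0 0 0 (-1) - 2*E 0 0 0 0))
    have u7z : u7 = 0 := by
      refine (mul_eq_zero.1 ?_).resolve_left hFp
      linear_combination (-1/6)*(E 0 0 0 2 - E 0 0 0 (-2) - 2*(E 0 0 0 1 - E 0 0 0 (-1)))
    have u0z : u0 = 0 := by
      refine (mul_eq_zero.1 ?_).resolve_left hFp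
      linear_combination -(E 0 0 0 1 + E 0 0 0 (-1) - 2*E 0 0 0 0)
    subst u6z u7z u0z
    refine ⟨rfl, ?_, rfl, ?_, rfl, ?_⟩
    · refine (mul_eq_zero.1 ?_).resolve_left hhv
      linear_combination (1/6)*(E 0 0 2 0 - E 0 0 (-2) 0 - 2*(E 0 0 1 0 - E 0 0 (-1) 0))
    · refine (mul_eq_zero.1 ?_).resolve_left hhv
      linear_combination (E 0 0 1 1 + E 0 0 (-1) 1 - 2*E 0 0 0 1
        - (E 0 0 1 0 + E 0 0 (-1) 0 - 2*E 0 0 0 0))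
    · refine (mul_eq_zero.1 ?_).resolve_left hhv
      linear_combination (E 0 0 1 0 + E 0 0 (-1) 0 - 2*E 0 0 0 0)

lemma hasDerivAt_rpow_log {f : ℝ → ℝ} {f' x : ℝ} (p : ℝ) (hf : HasDerivAt f f' x) (h : 0 < f x) :
    HasDerivAt (fun s => f s ^ p) (f x ^ p * (p * f' / f x)) x := by
  have := hf.rpow_const (p := p) (Or.inl h.ne')
  convert this using 1
  rw [Real.rpow_sub_one h.ne']
  field_simp

/-- metric functions -/
def Ff (d x : ℝ) : ℝ := ((x+1)/(x-1)) ^ d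
def Wf (d x y : ℝ) : ℝ := ((x+1)/(x-1)) ^ d * ((x^2-y^2) * (((x^2-1)/(x^2-y^2)) ^ (d^2)))

/-- the base region -/
def Om' (x y : ℝ) : Prop := 1 < x ∧ -1 < y ∧ y < 1

lemma Om'_pos {x y : ℝ} (h : Om' x y) : 0 < x - 1 ∧ 0 < x + 1 ∧ 0 < x^2-1 ∧ 0 < 1-y^2 ∧ 0 < x^2-y^2 := by
  obtain ⟨h1, h2, h3⟩ := h
  refine ⟨?_, ?_, ?_, ?_, ?_⟩ <;> nlinarith

lemma Ff_pos {d x y : ℝ} (h : Om' x y) : 0 < Ff d x := by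
  obtain ⟨h1, h2, h3, h4, h5⟩ := Om'_pos h
  exact Real.rpow_pos_of_pos (div_pos h2 h1) _

lemma Wf_pos {d x y : ℝ} (h : Om' x y) : 0 < Wf d x y := by
  obtain ⟨h1, h2, h3, h4, h5⟩ := Om'_pos h
  exact mul_pos (Real.rpow_pos_of_pos (div_pos h2 h1) _)
    (mul_pos h5 (Real.rpow_pos_of_pos (div_pos h3 h5) _))

lemma Ff_hasX {d x y : ℝ} (h : Om' x y) : HasDerivAt (fun s => Ff d s) (Ff d x * lph d x) x := by
  obtain ⟨h1, h2, h3, h4, h5⟩ := Om'_pos h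
  have h0 : HasDerivAt (fun s : ℝ => (s+1)/(s-1)) ((1*(x-1)-(x+1)*1)/(x-1)^2) x :=
    ((hasDerivAt_id x).add_const 1).div ((hasDerivAt_id x).sub_const 1) h1.ne'
  refine HasDerivAt.congr_deriv (hasDerivAt_rpow_log d h0 (div_pos h2 h1)) ?_
  unfold Ff lph
  congr 1
  have := h1.ne'; have := h2.ne'; have := h3.ne'
  have e : x^2-1 = (x-1)*(x+1) := by ring
  rw [e]
  field_simp
  ring

lemma Wf_hasX {d x y : ℝ} (h : Om' x y) :
    HasDerivAt (fun s => Wf d s y) (Wf d x y * om1 d x y) x := by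
  obtain ⟨h1, h2, h3, h4, h5⟩ := Om'_pos h
  have hq : HasDerivAt (fun s : ℝ => s^2-y^2) (2*x) x := by
    simpa using (hasDerivAt_pow 2 x).sub_const (y^2)
  have h1' : HasDerivAt (fun s : ℝ => s^2-1) (2*x) x := by
    simpa using (hasDerivAt_pow 2 x).sub_const (1:ℝ)
  have hr := hasDerivAt_rpow_log (d^2) (h1'.div hq h5.ne') (div_pos h3 h5)
  refine HasDerivAt.congr_deriv ((Ff_hasX (d := d) h).mul (hq.mul hr)) ?_
  simp only [Wf, Ff, om1, lph, Pi.mul_apply, Pi.div_apply]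
  generalize ((x^2-1)/(x^2-y^2)) ^ (d^2) = A
  generalize ((x+1)/(x-1)) ^ d = B
  field_simp
  ring

lemma Wf_hasY {d x y : ℝ} (h : Om' x y) :
    HasDerivAt (fun s => Wf d x s) (Wf d x y * om2 d x y) y := by
  obtain ⟨h1, h2, h3, h4, h5⟩ := Om'_pos h
  have hq : HasDerivAt (fun s : ℝ => x^2-s^2) (-(2*y)) y := by
    simpa using (hasDerivAt_pow 2 y).const_sub (x^2)
  have hr := hasDerivAt_rpow_log (d^2) ((hasDerivAt_const y (x^2-1)).div hq h5.ne') (div_pos h3 h5)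
  refine HasDerivAt.congr_deriv ((hq.mul hr).const_mul (Ff d x)) ?_
  simp only [Wf, Ff, om2, Pi.mul_apply, Pi.div_apply]
  generalize ((x^2-1)/(x^2-y^2)) ^ (d^2) = A
  generalize ((x+1)/(x-1)) ^ d = B
  field_simp
  ring

/-- the Hamiltonian in explicit variables -/
def Hm (d x y p q r s : ℝ) : ℝ :=
  (1/2) * (((x^2-1)*p^2 + (1-y^2)*q^2) / Wf d x y
    + r^2 / (Ff d x * ((x^2-1)*(1-y^2))) - Ff d x * s^2)

lemma Hm_hasX {d x y : ℝ} (h : Om' x y) (p q r s : ℝ) :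
    HasDerivAt (fun u => Hm d u y p q r s)
      ((1/2)*(2*x*p^2*(1/Wf d x y) - om1 d x y*(1/Wf d x y)*((x^2-1)*p^2+(1-y^2)*q^2)
        + (1/(Ff d x * ((x^2-1)*(1-y^2))))*lv1 d x*r^2 - Ff d x*lph d x*s^2)) x := by
  obtain ⟨h1, h2, h3, h4, h5⟩ := Om'_pos h
  have hW := (Wf_pos (d := d) h).ne'
  have hF := (Ff_pos (d := d) h).ne'
  have h1' : HasDerivAt (fun s : ℝ => s^2-1) (2*x) x := by
    simpa using (hasDerivAt_pow 2 x).sub_const (1:ℝ)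
  have A := (((h1'.mul_const (p^2)).add_const ((1-y^2)*q^2)).div (Wf_hasX (d := d) h) hW)
  have B := (hasDerivAt_const x (r^2)).div ((Ff_hasX (d := d) h).mul (h1'.mul_const (1-y^2)))
    (mul_pos (Ff_pos (d := d) h) (mul_pos h3 h4)).ne'
  have C := (Ff_hasX (d := d) h).mul_const (s^2)
  refine HasDerivAt.congr_deriv (((A.add B).sub C).const_mul (1/2)) ?_
  simp only [lv1, lph, Pi.mul_apply]
  field_simp
  ring

lemma Hm_hasY {d x y : ℝ} (h : Om' x y) (p q r s : ℝ) :
    HasDerivAt (fun u => Hm d x u p q r s)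
      ((1/2)*(-2*y*q^2*(1/Wf d x y) - om2 d x y*(1/Wf d x y)*((x^2-1)*p^2+(1-y^2)*q^2)
        + (1/(Ff d x * ((x^2-1)*(1-y^2))))*lv2 y*r^2)) y := by
  obtain ⟨h1, h2, h3, h4, h5⟩ := Om'_pos h
  have hW := (Wf_pos (d := d) h).ne'
  have hF := (Ff_pos (d := d) h).ne'
  have h1' : HasDerivAt (fun s : ℝ => 1-s^2) (-(2*y)) y := by
    simpa using (hasDerivAt_pow 2 y).const_sub (1:ℝ)
  have A := (((h1'.mul_const (q^2)).const_add ((x^2-1)*p^2)).div (Wf_hasY (d := d) h) hW)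
  have B := (hasDerivAt_const y (r^2)).div ((h1'.const_mul (x^2-1)).const_mul (Ff d x))
    (mul_pos (Ff_pos (d := d) h) (mul_pos h3 h4)).ne'
  refine HasDerivAt.congr_deriv (((A.add B).sub_const (Ff d x * s^2)).const_mul (1/2)) ?_
  simp only [lv2]
  field_simp
  ring

lemma Hm_hasP (d x y p q r s : ℝ) :
    HasDerivAt (fun u => Hm d x y u q r s) ((x^2-1)*p*(1/Wf d x y)) p := by
  have h1 : HasDerivAt (fun s : ℝ => s^2) (2*p) p := by simpa using hasDerivAt_pow 2 p
  refine HasDerivAt.congr_deriv (((((((h1.const_mul (x^2-1)).add_const ((1-y^2)*q^2)).div_const (Wf d x y)).add_const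
    (r^2 / (Ff d x * ((x^2-1)*(1-y^2))))).sub_const (Ff d x * s^2)).const_mul (1/2))) ?_
  ring

lemma Hm_hasQ (d x y p q r s : ℝ) :
    HasDerivAt (fun u => Hm d x y p u r s) ((1-y^2)*q*(1/Wf d x y)) q := by
  have h1 : HasDerivAt (fun s : ℝ => s^2) (2*q) q := by simpa using hasDerivAt_pow 2 q
  refine HasDerivAt.congr_deriv (((((((h1.const_mul (1-y^2)).const_add ((x^2-1)*p^2)).div_const (Wf d x y)).add_const
    (r^2 / (Ff d x * ((x^2-1)*(1-y^2))))).sub_const (Ff d x * s^2)).const_mul (1/2))) ?_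
  ring

lemma Om'_of {x y : ℝ} (h : (x, y) ∈ Om) : Om' x y := by
  obtain ⟨h1, h2, h3⟩ := h
  simp only at h1 h2 h3
  exact ⟨h1, by linarith, h3⟩

lemma T_hasX {d x y : ℝ} (h : Om' x y) :
    HasDerivAt (fun s => Ff d s * Wf d s y) (Ff d x * Wf d x y * (lph d x + om1 d x y)) x := by
  refine HasDerivAt.congr_deriv ((Ff_hasX (d := d) h).mul (Wf_hasX (d := d) h)) ?_
  ring

lemma T_hasY {d x y : ℝ} (h : Om' x y) :
    HasDerivAt (fun s => Ff d x * Wf d x s) (Ff d x * Wf d x y * om2 d x y) y := by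
  refine HasDerivAt.congr_deriv ((Wf_hasY (d := d) h).const_mul (Ff d x)) ?_
  ring

lemma R_hasX {d x y : ℝ} (h : Om' x y) :
    HasDerivAt (fun s => Wf d s y / (Ff d s * ((s^2-1)*(1-y^2))))
      (Wf d x y / (Ff d x * ((x^2-1)*(1-y^2))) * (lv1 d x + om1 d x y)) x := by
  obtain ⟨h1, h2, h3, h4, h5⟩ := Om'_pos h
  have hF := (Ff_pos (d := d) h).ne'
  have h1' : HasDerivAt (fun s : ℝ => s^2-1) (2*x) x := by
    simpa using (hasDerivAt_pow 2 x).sub_const (1:ℝ)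
  refine HasDerivAt.congr_deriv ((Wf_hasX (d := d) h).div ((Ff_hasX (d := d) h).mul (h1'.mul_const (1-y^2)))
    (mul_pos (Ff_pos (d := d) h) (mul_pos h3 h4)).ne') ?_
  simp only [lv1, lph, Pi.mul_apply]
  field_simp
  ring

lemma R_hasY {d x y : ℝ} (h : Om' x y) :
    HasDerivAt (fun s => Wf d x s / (Ff d x * ((x^2-1)*(1-s^2))))
      (Wf d x y / (Ff d x * ((x^2-1)*(1-y^2))) * (lv2 y + om2 d x y)) y := by
  obtain ⟨h1, h2, h3, h4, h5⟩ := Om'_pos h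
  have hF := (Ff_pos (d := d) h).ne'
  have h1' : HasDerivAt (fun s : ℝ => 1-s^2) (-(2*y)) y := by
    simpa using (hasDerivAt_pow 2 y).const_sub (1:ℝ)
  refine HasDerivAt.congr_deriv ((Wf_hasY (d := d) h).div ((h1'.const_mul (x^2-1)).const_mul (Ff d x))
    (mul_pos (Ff_pos (d := d) h) (mul_pos h3 h4)).ne') ?_
  simp only [lv2]
  field_simp
  ring

lemma final_alg (x y X Y w o1 o2 h v1 v2 F ph a ax ay cx c cy e66x e66y e77x e77y : ℝ)
    (hw : w ≠ 0) (hX : X ≠ 0) (hY : Y ≠ 0) (hac : Y*a = X*c)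
    (K1 : (2*x-o1*X)*a - X*ax - o2*X*0/2 = 0)
    (K2 : (2*x-o1*X)*0/2 - X*0 - o2*X*c - Y*ay = 0)
    (K3 : -o1*Y*a - X*cx + (-2*y-o2*Y)*0/2 - Y*0 = 0)
    (K4 : -o1*Y*0/2 + (-2*y-o2*Y)*c - Y*cy = 0)
    (h1 : -F*ph*a = X*w*e77x) (h2 : -F*ph*0 = 2*Y*w*e77y) (h3 : h*(2*v1*a+v2*0) = 2*X*w*e66x)
    (h4 : h*(v1*0+2*v2*c) = 2*Y*w*e66y) (p q r s : ℝ) :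
    ax*p^2 + cx*q^2 + e66x*r^2 + e77x*s^2 = 2*a/(X*w) *
      ((1/2)*(2*x*p^2*w - o1*w*(X*p^2+Y*q^2) + h*v1*r^2 - F*ph*s^2)) ∧
    ay*p^2 + cy*q^2 + e66y*r^2 + e77y*s^2 = 2*a/(X*w) *
      ((1/2)*(-2*y*q^2*w - o2*w*(X*p^2+Y*q^2) + h*v2*r^2)) ∧
    2*a*p = 2*a/(X*w) * (X*p*w) ∧ 2*c*q = 2*a/(X*w) * (Y*q*w) := by
  have ec : a = X*c/Y := by rw [eq_div_iff hY]; linear_combination hac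
  subst ec
  have e1 : ax = (2*x-o1*X)*c/Y := by
    have : X*ax = X*((2*x-o1*X)*c/Y) := by linear_combination -K1
    exact mul_left_cancel₀ hX this
  have e2 : ay = -o2*X*c/Y := by rw [eq_div_iff hY]; linear_combination -K2
  have e3 : cx = -o1*c := by
    have : X*cx = X*(-o1*c) := by
      have e : Y*(X*c/Y) = X*c := by field_simp
      linear_combination -K3 - o1*e
    exact mul_left_cancel₀ hX this
  have e4 : cy = (-2*y-o2*Y)*c/Y := by rw [eq_div_iff hY]; linear_combination -K4
  have e5 : e77x = -F*ph*c/(Y*w) := by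
    have : (X*w)*e77x = (X*w)*(-F*ph*c/(Y*w)) := by rw [← h1]; field_simp
    exact mul_left_cancel₀ (mul_ne_zero hX hw) this
  have e6 : e77y = 0 := by
    have : (2*Y*w)*e77y = 0 := by linear_combination -h2
    simpa [hY, hw] using this
  have e7 : e66x = h*v1*c/(Y*w) := by
    have : (2*X*w)*e66x = (2*X*w)*(h*v1*c/(Y*w)) := by rw [← h3]; field_simp; ring
    exact mul_left_cancel₀ (by positivity) this
  have e8 : e66y = h*v2*c/(Y*w) := by
    have : (2*Y*w)*e66y = (2*Y*w)*(h*v2*c/(Y*w)) := by rw [← h4]; field_simp; ring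
    exact mul_left_cancel₀ (by positivity) this
  subst e1 e2 e3 e4 e5 e6 e7 e8
  refine ⟨?_, ?_, ?_, ?_⟩ <;> field_simp <;> ring

/-- derivatives of the Hamiltonian -/
def Hx (d x y p q r s : ℝ) : ℝ :=
  (1/2)*(2*x*p^2*(1/Wf d x y) - om1 d x y*(1/Wf d x y)*((x^2-1)*p^2+(1-y^2)*q^2)
        + (1/(Ff d x * ((x^2-1)*(1-y^2))))*lv1 d x*r^2 - Ff d x*lph d x*s^2)
def Hy (d x y p q r : ℝ) : ℝ :=
  (1/2)*(-2*y*q^2*(1/Wf d x y) - om2 d x y*(1/Wf d x y)*((x^2-1)*p^2+(1-y^2)*q^2)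
        + (1/(Ff d x * ((x^2-1)*(1-y^2))))*lv2 y*r^2)

lemma Sm.zeroX {f : ℝ → ℝ → ℝ} (hf : Sm f) (h : ∀ x y, (x, y) ∈ Om → f x y = 0) {x y : ℝ}
    (hp : (x, y) ∈ Om) : _root_.dX f x y = 0 :=
  eqX (g := fun _ _ => 0) h hp (hf.hasX hp) (hasDerivAt_const x 0)

lemma Sm.zeroY {f : ℝ → ℝ → ℝ} (hf : Sm f) (h : ∀ x y, (x, y) ∈ Om → f x y = 0) {x y : ℝ}
    (hp : (x, y) ∈ Om) : _root_.dY f x y = 0 :=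
  eqY (g := fun _ _ => 0) h hp (hf.hasY hp) (hasDerivAt_const y 0)

lemma slice (d : ℝ) (hd : d ≠ 0) (hd1 : d^2-1 ≠ 0)
    (a b c u6 v6 u7 v7 u0 v0 e66 e67 e77 e6 e7 e0 : ℝ → ℝ → ℝ)
    (ha : Sm a) (hb : Sm b) (hc : Sm c) (hu6 : Sm u6) (hv6 : Sm v6) (hu7 : Sm u7) (hv7 : Sm v7) (hu0 : Sm u0) (hv0 : Sm v0) (he66 : Sm e66) (he67 : Sm e67) (he77 : Sm e77) (he6 : Sm e6) (he7 : Sm e7) (he0 : Sm e0)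
    (E : ∀ x y, (x, y) ∈ Om → ∀ p q r s : ℝ,
      Hx d x y p q r s * (2*a x y*p + b x y*q + u6 x y*r + u7 x y*s + u0 x y)
      - (x^2-1)*p*(1/Wf d x y) * (dX a x y*p^2 + dX b x y*(p*q) + dX c x y*q^2 + dX u6 x y*(p*r) + dX v6 x y*(q*r) + dX u7 x y*(p*s) + dX v7 x y*(q*s) + dX u0 x y*p + dX v0 x y*q + dX e66 x y*r^2 + dX e67 x y*(r*s) + dX e77 x y*s^2 + dX e6 x y*r + dX e7 x y*s + dX e0 x y)
      + Hy d x y p q r * (b x y*p + 2*c x y*q + v6 x y*r + v7 x y*s + v0 x y)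
      - (1-y^2)*q*(1/Wf d x y) * (dY a x y*p^2 + dY b x y*(p*q) + dY c x y*q^2 + dY u6 x y*(p*r) + dY v6 x y*(q*r) + dY u7 x y*(p*s) + dY v7 x y*(q*s) + dY u0 x y*p + dY v0 x y*q + dY e66 x y*r^2 + dY e67 x y*(r*s) + dY e77 x y*s^2 + dY e6 x y*r + dY e7 x y*s + dY e0 x y) = 0)
    (x y : ℝ) (hp : (x, y) ∈ Om) (hN : Npol d x y ≠ 0) :
    ∃ l : ℝ, ∀ p q r s : ℝ,
      dX a x y*p^2 + dX b x y*(p*q) + dX c x y*q^2 + dX u6 x y*(p*r) + dX v6 x y*(q*r) + dX u7 x y*(p*s) + dX v7 x y*(q*s) + dX u0 x y*p + dX v0 x y*q + dX e66 x y*r^2 + dX e67 x y*(r*s) + dX e77 x y*s^2 + dX e6 x y*r + dX e7 x y*s + dX e0 x y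
        = l * Hx d x y p q r s ∧
      dY a x y*p^2 + dY b x y*(p*q) + dY c x y*q^2 + dY u6 x y*(p*r) + dY v6 x y*(q*r) + dY u7 x y*(p*s) + dY v7 x y*(q*s) + dY u0 x y*p + dY v0 x y*q + dY e66 x y*r^2 + dY e67 x y*(r*s) + dY e77 x y*s^2 + dY e6 x y*r + dY e7 x y*s + dY e0 x y
        = l * Hy d x y p q r ∧
      2*a x y*p + b x y*q + u6 x y*r + u7 x y*s + u0 x y = l * ((x^2-1)*p*(1/Wf d x y)) ∧
      b x y*p + 2*c x y*q + v6 x y*r + v7 x y*s + v0 x y = l * ((1-y^2)*q*(1/Wf d x y)) := by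
  have ext : ∀ x y, (x, y) ∈ Om → _ := fun x y hp =>
    extract x y (x^2-1) (1-y^2) (1/Wf d x y) (om1 d x y) (om2 d x y)
      (1/(Ff d x * ((x^2-1)*(1-y^2)))) (lv1 d x) (lv2 y) (Ff d x) (lph d x)
      (a x y) (dX a x y) (dY a x y) (b x y) (dX b x y) (dY b x y) (c x y) (dX c x y) (dY c x y) (u6 x y) (dX u6 x y) (dY u6 x y) (v6 x y) (dX v6 x y) (dY v6 x y) (u7 x y) (dX u7 x y) (dY u7 x y) (v7 x y) (dX v7 x y) (dY v7 x y) (u0 x y) (dX u0 x y) (dY u0 x y) (v0 x y) (dX v0 x y) (dY v0 x y) (dX e66 x y) (dY e66 x y) (dX e67 x y) (dY e67 x y) (dX e77 x y) (dY e77 x y) (dX e6 x y) (dY e6 x y) (dX e7 x y) (dY e7 x y) (dX e0 x y) (dY e0 x y)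
      (one_div_ne_zero (Wf_pos (Om'_of hp)).ne')
      (one_div_ne_zero (mul_ne_zero (Ff_pos (Om'_of hp)).ne'
        (mul_ne_zero (om_ne hp).1 (om_ne hp).2.1)))
      (Ff_pos (Om'_of hp)).ne'
      (div_ne_zero (mul_ne_zero (by norm_num) hd) (om_ne hp).1)
      (div_ne_zero (mul_ne_zero (by norm_num) (om_ne hp).2.2.2) (om_ne hp).2.1)
      (om_ne hp).1 (om_ne hp).2.1 (E x y hp)
  have key := core d hd hd1 a b c e66 e77 (fun x y => Ff d x * Wf d x y)
    (fun x y => Wf d x y / (Ff d x * ((x^2-1)*(1-y^2)))) ha hb hc he66 he77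
    (fun x y hp => mul_ne_zero (Ff_pos (Om'_of hp)).ne' (Wf_pos (Om'_of hp)).ne')
    (fun x y hp => T_hasX (Om'_of hp)) (fun x y hp => T_hasY (Om'_of hp))
    (fun x y hp => div_ne_zero (Wf_pos (Om'_of hp)).ne' (mul_ne_zero (Ff_pos (Om'_of hp)).ne'
        (mul_ne_zero (om_ne hp).1 (om_ne hp).2.1)))
    (fun x y hp => R_hasX (Om'_of hp)) (fun x y hp => R_hasY (Om'_of hp))
    (fun x y hp => (ext x y hp).1.1) (fun x y hp => (ext x y hp).1.2.1)
    (fun x y hp => (ext x y hp).1.2.2.1) (fun x y hp => (ext x y hp).1.2.2.2)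
    (by
      intro x y hp
      have h := (ext x y hp).2.1.1
      obtain ⟨hX, hY, hQ, hy⟩ := om_ne hp
      have hW := (Wf_pos (d := d) (Om'_of hp)).ne'
      simp only [lph] at h
      field_simp at h ⊢
      linear_combination -h)
    (by
      intro x y hp
      have h := (ext x y hp).2.1.2.1
      obtain ⟨hX, hY, hQ, hy⟩ := om_ne hp
      have hW := (Wf_pos (d := d) (Om'_of hp)).ne'
      simp only [lph] at h
      field_simp at h ⊢
      linear_combination -h)
    (by
      intro x y hp
      have h := (ext x y hp).2.1.2.2.1
      obtain ⟨hX, hY, hQ, hy⟩ := om_ne hp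
      have hW := (Wf_pos (d := d) (Om'_of hp)).ne'
      have hF := (Ff_pos (d := d) (Om'_of hp)).ne'
      generalize lv1 d x = v1 at *
      generalize lv2 y = v2 at *
      field_simp at h ⊢
      linear_combination -h)
    (by
      intro x y hp
      have h := (ext x y hp).2.1.2.2.2
      obtain ⟨hX, hY, hQ, hy⟩ := om_ne hp
      have hW := (Wf_pos (d := d) (Om'_of hp)).ne'
      have hF := (Ff_pos (d := d) (Om'_of hp)).ne'
      generalize lv1 d x = v1 at *
      generalize lv2 y = v2 at *
      field_simp at h ⊢
      linear_combination -h)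
    x y hp hN
  obtain ⟨hac, hb0, hbx, hby⟩ := key
  obtain ⟨⟨K1, K2, K3, K4⟩, ⟨h1, h2, h3, h4⟩, ⟨g1, g2, g3, g4, g5, g6, g7, g8⟩,
    ⟨w1, w2, w3, w4, w5, w6⟩⟩ := ext x y hp
  have Xu6 : dX u6 x y = 0 := hu6.zeroX (fun x y hp => (ext x y hp).2.2.2.1) hp
  have Yu6 : dY u6 x y = 0 := hu6.zeroY (fun x y hp => (ext x y hp).2.2.2.1) hp
  have Xv6 : dX v6 x y = 0 := hv6.zeroX (fun x y hp => (ext x y hp).2.2.2.2.1) hp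
  have Yv6 : dY v6 x y = 0 := hv6.zeroY (fun x y hp => (ext x y hp).2.2.2.2.1) hp
  have Xu7 : dX u7 x y = 0 := hu7.zeroX (fun x y hp => (ext x y hp).2.2.2.2.2.1) hp
  have Yu7 : dY u7 x y = 0 := hu7.zeroY (fun x y hp => (ext x y hp).2.2.2.2.2.1) hp
  have Xv7 : dX v7 x y = 0 := hv7.zeroX (fun x y hp => (ext x y hp).2.2.2.2.2.2.1) hp
  have Yv7 : dY v7 x y = 0 := hv7.zeroY (fun x y hp => (ext x y hp).2.2.2.2.2.2.1) hp
  have Xu0 : dX u0 x y = 0 := hu0.zeroX (fun x y hp => (ext x y hp).2.2.2.2.2.2.2.1) hp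
  have Yu0 : dY u0 x y = 0 := hu0.zeroY (fun x y hp => (ext x y hp).2.2.2.2.2.2.2.1) hp
  have Xv0 : dX v0 x y = 0 := hv0.zeroX (fun x y hp => (ext x y hp).2.2.2.2.2.2.2.2) hp
  have Yv0 : dY v0 x y = 0 := hv0.zeroY (fun x y hp => (ext x y hp).2.2.2.2.2.2.2.2) hp
  rw [hb0, hbx] at K2
  rw [hb0] at K1 K4 h2 h3 h4
  rw [hb0, hby] at K3
  refine ⟨2*a x y/((x^2-1)*(1/Wf d x y)), fun p q r s => ?_⟩
  obtain ⟨f1, f2, f3, f4⟩ := final_alg x y _ _ _ _ _ _ _ _ _ _ _ _ _ _ _ _ _ _ _ _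
    (one_div_ne_zero (Wf_pos (d := d) (Om'_of hp)).ne') (om_ne hp).1 (om_ne hp).2.1
    hac K1 K2 K3 K4 h1 h2 h3 h4 p q r s
  rw [Xu6, Yu6, Xv6, Yv6, Xu7, Yu7, Xv7, Yv7, Xu0, Yu0, Xv0, Yv0, hb0, hbx, hby, g1, g2, g3, g4, g5, g6, g7, g8, w1, w2, w3, w4, w5, w6]
  unfold Hx Hy
  rw [← f1, ← f2, ← f3, ← f4]
  refine ⟨?_, ?_, ?_, ?_⟩ <;> ring

/-- phase-space point from coordinates -/
def mk (x y f t p q r s : ℝ) : PhasePt := ![x, y, f, t, p, q, r, s]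

lemma pd_line {f : PhasePt → ℝ} {z : PhasePt} (i : Fin 8) (hf : DifferentiableAt ℝ f z) :
    HasDerivAt (fun s => f (Function.update z i s)) (pd i f z) (z i) := by
  have h1 : HasDerivAt (Function.update z i) (Pi.single i (1:ℝ)) (z i) := hasDerivAt_update z i (z i)
  have h2 : HasFDerivAt f (fderiv ℝ f z) (Function.update z i (z i)) := by
    rw [Function.update_eq_self]; exact hf.hasFDerivAt
  exact h2.comp_hasDerivAt (z i) h1

lemma mk_eta (z : PhasePt) : mk (z 0) (z 1) (z 2) (z 3) (z 4) (z 5) (z 6) (z 7) = z := by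
  ext i; fin_cases i <;> rfl

lemma up0 (x y f t p q r s u : ℝ) : Function.update (mk x y f t p q r s) 0 u = mk u y f t p q r s := by
  ext i; fin_cases i <;> rfl
lemma up1 (x y f t p q r s u : ℝ) : Function.update (mk x y f t p q r s) 1 u = mk x u f t p q r s := by
  ext i; fin_cases i <;> rfl
lemma up2 (x y f t p q r s u : ℝ) : Function.update (mk x y f t p q r s) 2 u = mk x y u t p q r s := by
  ext i; fin_cases i <;> rfl
lemma up3 (x y f t p q r s u : ℝ) : Function.update (mk x y f t p q r s) 3 u = mk x y f u p q r s := by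
  ext i; fin_cases i <;> rfl
lemma up4 (x y f t p q r s u : ℝ) : Function.update (mk x y f t p q r s) 4 u = mk x y f t u q r s := by
  ext i; fin_cases i <;> rfl
lemma up5 (x y f t p q r s u : ℝ) : Function.update (mk x y f t p q r s) 5 u = mk x y f t p u r s := by
  ext i; fin_cases i <;> rfl

lemma HamD_mk (d x y f t p q r s : ℝ) : HamD d (mk x y f t p q r s) = Hm d x y p q r s := rfl

lemma mk_mem {x y : ℝ} (f t p q r s : ℝ) (h : Om' x y) : mk x y f t p q r s ∈ TStar := h

lemma HamD_diff (d : ℝ) {z : PhasePt} (hz : z ∈ TStar) : DifferentiableAt ℝ (HamD d) z := by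
  have h : Om' (z 0) (z 1) := hz
  obtain ⟨h1, h2, h3, h4, h5⟩ := Om'_pos h
  have hA : DifferentiableAt ℝ (fun z : PhasePt => ((z 0 + 1)/(z 0 - 1)) ^ d) z := by
    have n : z 0 - 1 ≠ 0 := h1.ne'
    have e : DifferentiableAt ℝ (fun z : PhasePt => (z 0 + 1)/(z 0 - 1)) z := by
      fun_prop (disch := exact n)
    exact e.rpow_const (Or.inl (div_pos h2 h1).ne')
  have hB : DifferentiableAt ℝ (fun z : PhasePt =>
      (((z 0)^2 - 1)/((z 0)^2 - (z 1)^2)) ^ (d^2)) z := by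
    have n : (z 0)^2 - (z 1)^2 ≠ 0 := h5.ne'
    have e : DifferentiableAt ℝ (fun z : PhasePt => ((z 0)^2 - 1)/((z 0)^2 - (z 1)^2)) z := by
      fun_prop (disch := exact n)
    exact e.rpow_const (Or.inl (div_pos h3 h5).ne')
  have c1 : DifferentiableAt ℝ (fun z : PhasePt =>
      ((z 0)^2 - 1) * (z 4)^2 + (1 - (z 1)^2) * (z 5)^2) z := by fun_prop
  have c2 : DifferentiableAt ℝ (fun z : PhasePt => (z 0)^2 - (z 1)^2) z := by fun_prop
  have c3 : DifferentiableAt ℝ (fun z : PhasePt => (z 6)^2) z := by fun_prop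
  have c4 : DifferentiableAt ℝ (fun z : PhasePt => ((z 0)^2 - 1) * (1 - (z 1)^2)) z := by fun_prop
  have c5 : DifferentiableAt ℝ (fun z : PhasePt => (z 7)^2) z := by fun_prop
  have n1 : ((z 0 + 1)/(z 0 - 1)) ^ d *
      (((z 0)^2 - (z 1)^2) * ((((z 0)^2 - 1)/((z 0)^2 - (z 1)^2)) ^ (d^2))) ≠ 0 :=
    (Wf_pos (d := d) h).ne'
  have n2 : ((z 0 + 1)/(z 0 - 1)) ^ d * (((z 0)^2 - 1) * (1 - (z 1)^2)) ≠ 0 :=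
    (mul_pos (Ff_pos (d := d) h) (mul_pos h3 h4)).ne'
  have m1 : DifferentiableAt ℝ (fun z : PhasePt => ((z 0 + 1)/(z 0 - 1)) ^ d *
      (((z 0)^2 - (z 1)^2) * ((((z 0)^2 - 1)/((z 0)^2 - (z 1)^2)) ^ (d^2)))) z :=
    hA.mul (c2.mul hB)
  have m2 : DifferentiableAt ℝ (fun z : PhasePt => ((z 0 + 1)/(z 0 - 1)) ^ d *
      (((z 0)^2 - 1) * (1 - (z 1)^2))) z := hA.mul c4
  have t1 := c1.mul (m1.inv n1)
  have t2 := c3.mul (m2.inv n2)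
  have t3 := hA.mul c5
  exact ((t1.add t2).sub t3).const_mul (1/2)

lemma HamD_pd (d : ℝ) {x y : ℝ} (f t p q r s : ℝ) (h : Om' x y) :
    pd 0 (HamD d) (mk x y f t p q r s) = Hx d x y p q r s ∧
    pd 1 (HamD d) (mk x y f t p q r s) = Hy d x y p q r ∧
    pd 2 (HamD d) (mk x y f t p q r s) = 0 ∧
    pd 3 (HamD d) (mk x y f t p q r s) = 0 ∧
    pd 4 (HamD d) (mk x y f t p q r s) = (x^2-1)*p*(1/Wf d x y) ∧
    pd 5 (HamD d) (mk x y f t p q r s) = (1-y^2)*q*(1/Wf d x y) := by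
  have hd := HamD_diff d (mk_mem f t p q r s h)
  have l0 := pd_line 0 hd
  have l1 := pd_line 1 hd
  have l2 := pd_line 2 hd
  have l3 := pd_line 3 hd
  have l4 := pd_line 4 hd
  have l5 := pd_line 5 hd
  simp only [up0, up1, up2, up3, up4, up5, HamD_mk] at l0 l1 l2 l3 l4 l5
  exact ⟨l0.unique (Hm_hasX h p q r s), l1.unique (Hm_hasY h p q r s),
    l2.unique (hasDerivAt_const _ _), l3.unique (hasDerivAt_const _ _),
    l4.unique (Hm_hasP d x y p q r s), l5.unique (Hm_hasQ d x y p q r s)⟩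

lemma pd_Pphi (i : Fin 8) (z : PhasePt) : pd i Pphi z = if i = 6 then 1 else 0 := by
  have : HasFDerivAt Pphi (ContinuousLinearMap.proj (R := ℝ) (φ := fun _ : Fin 8 => ℝ) 6) z :=
    (ContinuousLinearMap.proj (R := ℝ) (φ := fun _ : Fin 8 => ℝ) 6).hasFDerivAt
  unfold pd
  rw [this.fderiv]
  simp [Pi.single_apply, eq_comm]

lemma pd_Ptm (i : Fin 8) (z : PhasePt) : pd i Ptm z = if i = 7 then 1 else 0 := by
  have : HasFDerivAt Ptm (ContinuousLinearMap.proj (R := ℝ) (φ := fun _ : Fin 8 => ℝ) 7) z :=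
    (ContinuousLinearMap.proj (R := ℝ) (φ := fun _ : Fin 8 => ℝ) 7).hasFDerivAt
  unfold pd
  rw [this.fderiv]
  simp [Pi.single_apply, eq_comm]

lemma pois_Pphi (g : PhasePt → ℝ) (z : PhasePt) : pois Pphi g z = - pd 2 g z := by
  simp [pois, pd_Pphi]

lemma pois_Ptm (g : PhasePt → ℝ) (z : PhasePt) : pois Ptm g z = - pd 3 g z := by
  simp [pois, pd_Ptm]

lemma pd_I (I : PhasePt → ℝ) (f t : ℝ)
    (a b c u6 v6 u7 v7 u0 v0 e66 e67 e77 e6 e7 e0 : ℝ → ℝ → ℝ)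
    (ha : Sm a) (hb : Sm b) (hc : Sm c) (hu6 : Sm u6) (hv6 : Sm v6) (hu7 : Sm u7) (hv7 : Sm v7) (hu0 : Sm u0) (hv0 : Sm v0) (he66 : Sm e66) (he67 : Sm e67) (he77 : Sm e77) (he6 : Sm e6) (he7 : Sm e7) (he0 : Sm e0)
    (hI : ∀ x y, (x, y) ∈ Om → ∀ p q r s, I (mk x y f t p q r s) =
      a x y*p^2 + b x y*(p*q) + c x y*q^2 + u6 x y*(p*r) + v6 x y*(q*r) + u7 x y*(p*s) + v7 x y*(q*s) + u0 x y*p + v0 x y*q + e66 x y*r^2 + e67 x y*(r*s) + e77 x y*s^2 + e6 x y*r + e7 x y*s + e0 x y)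
    (x y : ℝ) (hp : (x, y) ∈ Om) (p q r s : ℝ) (hd : DifferentiableAt ℝ I (mk x y f t p q r s)) :
    pd 0 I (mk x y f t p q r s) =
      dX a x y*p^2 + dX b x y*(p*q) + dX c x y*q^2 + dX u6 x y*(p*r) + dX v6 x y*(q*r) + dX u7 x y*(p*s) + dX v7 x y*(q*s) + dX u0 x y*p + dX v0 x y*q + dX e66 x y*r^2 + dX e67 x y*(r*s) + dX e77 x y*s^2 + dX e6 x y*r + dX e7 x y*s + dX e0 x y ∧
    pd 1 I (mk x y f t p q r s) =
      dY a x y*p^2 + dY b x y*(p*q) + dY c x y*q^2 + dY u6 x y*(p*r) + dY v6 x y*(q*r) + dY u7 x y*(p*s) + dY v7 x y*(q*s) + dY u0 x y*p + dY v0 x y*q + dY e66 x y*r^2 + dY e67 x y*(r*s) + dY e77 x y*s^2 + dY e6 x y*r + dY e7 x y*s + dY e0 x y ∧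
    pd 4 I (mk x y f t p q r s) = 2*a x y*p + b x y*q + u6 x y*r + u7 x y*s + u0 x y ∧
    pd 5 I (mk x y f t p q r s) = b x y*p + 2*c x y*q + v6 x y*r + v7 x y*s + v0 x y := by
  have l0 := pd_line 0 hd
  have l1 := pd_line 1 hd
  have l4 := pd_line 4 hd
  have l5 := pd_line 5 hd
  simp only [up0, up1, up4, up5] at l0 l1 l4 l5
  refine ⟨?_, ?_, ?_, ?_⟩
  · exact eqX (f := fun x y => I (mk x y f t p q r s)) (fun x y hp => hI x y hp p q r s) hp l0
      ((((((((((((((((ha.hasX hp).mul_const (p^2)).add ((hb.hasX hp).mul_const ((p*q)))).add ((hc.hasX hp).mul_const (q^2))).add ((hu6.hasX hp).mul_const ((p*r)))).add ((hv6.hasX hp).mul_const ((q*r)))).add ((hu7.hasX hp).mul_const ((p*s)))).add ((hv7.hasX hp).mul_const ((q*s)))).add ((hu0.hasX hp).mul_const (p))).add ((hv0.hasX hp).mul_const (q))).add ((he66.hasX hp).mul_const (r^2))).add ((he67.hasX hp).mul_const ((r*s)))).add ((he77.hasX hp).mul_const (s^2))).add ((he6.hasX hp).mul_const (r))).add ((he7.hasX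 hp).mul_const (s))).add ((he0.hasX hp)))
  · exact eqY (f := fun x y => I (mk x y f t p q r s)) (fun x y hp => hI x y hp p q r s) hp l1
      ((((((((((((((((ha.hasY hp).mul_const (p^2)).add ((hb.hasY hp).mul_const ((p*q)))).add ((hc.hasY hp).mul_const (q^2))).add ((hu6.hasY hp).mul_const ((p*r)))).add ((hv6.hasY hp).mul_const ((q*r)))).add ((hu7.hasY hp).mul_const ((p*s)))).add ((hv7.hasY hp).mul_const ((q*s)))).add ((hu0.hasY hp).mul_const (p))).add ((hv0.hasY hp).mul_const (q))).add ((he66.hasY hp).mul_const (r^2))).add ((he67.hasY hp).mul_const ((r*s)))).add ((he77.hasY hp).mul_const (s^2))).add ((he6.hasY hp).mul_const (r))).add ((he7.hasY hp).mul_const (s))).add ((he0.hasY hp)))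
  · simp only [hI x y hp] at l4
    have h0 : HasDerivAt (fun u : ℝ => (a x y)*u^2 + (2*a x y*p + b x y*q + u6 x y*r + u7 x y*s + u0 x y - 2*a x y*p)*u + (I (mk x y f t 0 q r s))) (a x y * (2*p) + (2*a x y*p + b x y*q + u6 x y*r + u7 x y*s + u0 x y - 2*a x y*p)*1) p := by
      have h1 : HasDerivAt (fun s : ℝ => s^2) (2*p) p := by simpa using hasDerivAt_pow 2 p
      exact ((h1.const_mul _).add ((hasDerivAt_id p).const_mul _)).add_const _
    have h2 := l4.unique (h0.congr_of_eventuallyEq (Filter.Eventually.of_forall (fun u => by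
      simp only [hI x y hp]; ring)))
    rw [show pd 4 I (mk x y f t p q r s) = _ from h2]; ring
  · simp only [hI x y hp] at l5
    have h0 : HasDerivAt (fun u : ℝ => (c x y)*u^2 + (b x y*p + 2*c x y*q + v6 x y*r + v7 x y*s + v0 x y - 2*c x y*q)*u + (I (mk x y f t p 0 r s))) (c x y * (2*q) + (b x y*p + 2*c x y*q + v6 x y*r + v7 x y*s + v0 x y - 2*c x y*q)*1) q := by
      have h1 : HasDerivAt (fun s : ℝ => s^2) (2*q) q := by simpa using hasDerivAt_pow 2 q
      exact ((h1.const_mul _).add ((hasDerivAt_id q).const_mul _)).add_const _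
    have h2 := l5.unique (h0.congr_of_eventuallyEq (Filter.Eventually.of_forall (fun u => by
      simp only [hI x y hp]; ring)))
    rw [show pd 5 I (mk x y f t p q r s) = _ from h2]; ring

/-- coefficient slices -/
def sl (C : ℕ → ℕ → ℕ → ℕ → ((Fin 4 → ℝ) → ℝ)) (f t : ℝ) (i j k m : ℕ) : ℝ → ℝ → ℝ :=
  fun x y => C i j k m ![x, y, f, t]

lemma sl_Sm {C : ℕ → ℕ → ℕ → ℕ → ((Fin 4 → ℝ) → ℝ)}
    (hC : ∀ i j k m, ContDiffOn ℝ (⊤ : ℕ∞) (C i j k m) Ubase) (f t : ℝ) (i j k m : ℕ) :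
    Sm (sl C f t i j k m) := by
  have h : ContDiff ℝ (⊤ : ℕ∞) (fun p : ℝ × ℝ => (![p.1, p.2, f, t] : Fin 4 → ℝ)) := by
    rw [contDiff_pi]
    intro i
    fin_cases i
    · exact contDiff_fst
    · exact contDiff_snd
    · exact contDiff_const
    · exact contDiff_const
  exact (hC i j k m).comp h.contDiffOn (fun p hp => Om'_of (x := p.1) (y := p.2) hp)

lemma I_mk {I : PhasePt → ℝ} {C : ℕ → ℕ → ℕ → ℕ → ((Fin 4 → ℝ) → ℝ)}
    (hI : ∀ z ∈ TStar, I z =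
      ∑ i ∈ Finset.range (2+1), ∑ j ∈ Finset.range (2+1),
      ∑ k ∈ Finset.range (2+1), ∑ m ∈ Finset.range (2+1),
        (if i + j + k + m ≤ 2 then
          C i j k m (basePt z) * (z 4)^i * (z 5)^j * (z 6)^k * (z 7)^m else 0))
    (f t x y : ℝ) (hp : (x, y) ∈ Om) (p q r s : ℝ) : I (mk x y f t p q r s) =
      sl C f t 2 0 0 0 x y*p^2 + sl C f t 1 1 0 0 x y*(p*q) + sl C f t 0 2 0 0 x y*q^2 + sl C f t 1 0 1 0 x y*(p*r) + sl C f t 0 1 1 0 x y*(q*r) + sl C f t 1 0 0 1 x y*(p*s) + sl C f t 0 1 0 1 x y*(q*s) + sl C f t 1 0 0 0 x y*p + sl C f t 0 1 0 0 x y*q + sl C f t 0 0 2 0 x y*r^2 + sl C f t 0 0 1 1 x y*(r*s) + sl C f t 0 0 0 2 x y*s^2 + sl C f t 0 0 1 0 x y*r + sl C f t 0 0 0 1 x y*s + sl C f t 0 0 0 0 x y := by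
  have hb : basePt (mk x y f t p q r s) = ![x, y, f, t] := by
    ext i; fin_cases i <;> rfl
  have h4 : mk x y f t p q r s 4 = p := rfl
  have h5 : mk x y f t p q r s 5 = q := rfl
  have h6 : mk x y f t p q r s 6 = r := rfl
  have h7 : mk x y f t p q r s 7 = s := rfl
  rw [hI _ (mk_mem f t p q r s (Om'_of hp)), hb, h4, h5, h6, h7]
  simp [Finset.sum_range_succ, sl]
  ring

lemma exists_point (d : ℝ) (hd : d ≠ 0) : ∃ x : ℝ, 1 < x ∧ Npol d x (1/2) ≠ 0 := by
  by_contra hc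
  push Not at hc
  have a := hc 2 (by norm_num)
  have b := hc 3 (by norm_num)
  have c := hc 4 (by norm_num)
  unfold Npol at a b c
  apply hd
  have : d^2 = 0 := by linear_combination (a - 2*b + c)/18
  simpa using this

lemma fderiv_comb (I H : PhasePt → ℝ) (z : PhasePt) (l : ℝ)
    (h0 : pd 0 I z = l * pd 0 H z) (h1 : pd 1 I z = l * pd 1 H z)
    (h2 : pd 2 I z = l * pd 2 H z) (h3 : pd 3 I z = l * pd 3 H z)
    (h4 : pd 4 I z = l * pd 4 H z) (h5 : pd 5 I z = l * pd 5 H z) :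
    ¬ LinearIndependent ℝ ![fderiv ℝ H z, fderiv ℝ Pphi z, fderiv ℝ Ptm z, fderiv ℝ I z] := by
  intro hL
  rw [Fintype.linearIndependent_iff] at hL
  have := hL ![l, pd 6 I z - l * pd 6 H z, pd 7 I z - l * pd 7 H z, -1] (by
    simp only [Fin.sum_univ_four, Matrix.cons_val]
    refine ContinuousLinearMap.coe_injective ?_
    refine LinearMap.pi_ext' fun i => LinearMap.ext_ring ?_
    show l * pd i H z + (pd 6 I z - l * pd 6 H z) * pd i Pphi z
      + (pd 7 I z - l * pd 7 H z) * pd i Ptm z + (-1) * pd i I z = 0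
    rw [pd_Pphi, pd_Ptm]
    fin_cases i <;> simp <;> linarith) 3
  simp at this

lemma isOpen_TStar : IsOpen TStar := by
  have : TStar = {z : PhasePt | 1 < z 0} ∩ ({z : PhasePt | -1 < z 1} ∩ {z : PhasePt | z 1 < 1}) := by
    ext p; simp [TStar]
  rw [this]
  exact (isOpen_lt continuous_const (by fun_prop)).inter
    ((isOpen_lt continuous_const (by fun_prop)).inter (isOpen_lt (by fun_prop) continuous_const))

lemma exists_good (d : ℝ) (hd : d ≠ 0) (S : Set PhasePt) (hS : TStar ⊆ closure S) :
    ∃ z ∈ S, (z 0, z 1) ∈ Om ∧ Npol d (z 0) (z 1) ≠ 0 := by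
  obtain ⟨x, hx, hN⟩ := exists_point d hd
  have hV : IsOpen {z : PhasePt | (z 0, z 1) ∈ Om ∧ Npol d (z 0) (z 1) ≠ 0} := by
    refine IsOpen.inter (isOpen_Om.preimage (by fun_prop : Continuous fun z : PhasePt => (z 0, z 1))) ?_
    exact isOpen_ne_fun (by unfold Npol; fun_prop) continuous_const
  have hz : mk x (1/2) 0 0 0 0 0 0 ∈ closure S :=
    hS ⟨hx, by show (-1:ℝ) < 1/2; norm_num, by show (1/2:ℝ) < 1; norm_num⟩
  obtain ⟨w, hw1, hw2⟩ := mem_closure_iff.1 hz _ hV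
    ⟨⟨hx, by show (0:ℝ) < 1/2; norm_num, by show (1/2:ℝ) < 1; norm_num⟩, hN⟩
  exact ⟨w, hw2, hw1⟩

/-- for `δ ∉ {-1, 0, 1}` there is no nontrivial quadratic integral. -/
theorem no_quadratic_integral (d : ℝ) (h1 : d ≠ -1) (h2 : d ≠ 0) (h3 : d ≠ 1) :
    ¬ ∃ I : PhasePt → ℝ, ContDiffOn ℝ (⊤ : ℕ∞) I TStar ∧ IsPolyMom 2 I ∧
      (∀ z ∈ TStar,
        pois (HamD d) Pphi z = 0 ∧ pois (HamD d) Ptm z = 0 ∧ pois Pphi Ptm z = 0 ∧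
        pois (HamD d) I z = 0 ∧ pois Pphi I z = 0 ∧ pois Ptm I z = 0) ∧
      FunIndep (HamD d) Pphi Ptm I := by
  rintro ⟨I, hsm, ⟨C, hC, hI⟩, hpois, S, hST, hS, hL⟩
  have hd1 : d^2 - 1 ≠ 0 := by
    have : d^2-1 = (d-1)*(d+1) := by ring
    rw [this]
    refine mul_ne_zero (sub_ne_zero.2 h3) ?_
    intro h
    exact h1 (by linarith)
  obtain ⟨z, hzS, hzO, hzN⟩ := exists_good d h2 S hS
  have hdiff : ∀ w ∈ TStar, DifferentiableAt ℝ I w := fun w hw =>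
    (hsm.contDiffAt (isOpen_TStar.mem_nhds hw)).differentiableAt (by simp)
  have hpd2 : ∀ w ∈ TStar, pd 2 I w = 0 := fun w hw => by
    have := (hpois w hw).2.2.2.2.1
    rw [pois_Pphi] at this
    linarith
  have hpd3 : ∀ w ∈ TStar, pd 3 I w = 0 := fun w hw => by
    have := (hpois w hw).2.2.2.2.2
    rw [pois_Ptm] at this
    linarith
  have hpdI : ∀ x y, (x, y) ∈ Om → ∀ p q r s : ℝ, _ := fun x y hp p q r s =>
    pd_I I (z 2) (z 3) (sl C (z 2) (z 3) 2 0 0 0) (sl C (z 2) (z 3) 1 1 0 0) (sl C (z 2) (z 3) 0 2 0 0) (sl C (z 2) (z 3) 1 0 1 0) (sl C (z 2) (z 3) 0 1 1 0) (sl C (z 2) (z 3) 1 0 0 1) (sl C (z 2) (z 3) 0 1 0 1) (sl C (z 2) (z 3) 1 0 0 0) (sl C (z 2) (z 3) 0 1 0 0) (sl C (z 2) (z 3) 0 0 2 0) (sl C (z 2) (z 3) 0 0 1 1) (sl C (z 2) (z 3) 0 0 0 2) (sl C (z 2) (z 3) 0 0 1 0) (sl C (z 2) (z 3) 0 0 0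 1) (sl C (z 2) (z 3) 0 0 0 0)
      (sl_Sm hC (z 2) (z 3) 2 0 0 0) (sl_Sm hC (z 2) (z 3) 1 1 0 0) (sl_Sm hC (z 2) (z 3) 0 2 0 0) (sl_Sm hC (z 2) (z 3) 1 0 1 0) (sl_Sm hC (z 2) (z 3) 0 1 1 0) (sl_Sm hC (z 2) (z 3) 1 0 0 1) (sl_Sm hC (z 2) (z 3) 0 1 0 1) (sl_Sm hC (z 2) (z 3) 1 0 0 0) (sl_Sm hC (z 2) (z 3) 0 1 0 0) (sl_Sm hC (z 2) (z 3) 0 0 2 0) (sl_Sm hC (z 2) (z 3) 0 0 1 1) (sl_Sm hC (z 2) (z 3) 0 0 0 2) (sl_Sm hC (z 2) (z 3) 0 0 1 0) (sl_Sm hC (z 2) (z 3) 0 0 0 1) (sl_Sm hC (z 2) (z 3) 0 0 0 0)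
      (I_mk hI (z 2) (z 3)) x y hp p q r s (hdiff _ (mk_mem _ _ _ _ _ _ (Om'_of hp)))
  obtain ⟨l, hl⟩ := slice d h2 hd1 (sl C (z 2) (z 3) 2 0 0 0) (sl C (z 2) (z 3) 1 1 0 0) (sl C (z 2) (z 3) 0 2 0 0) (sl C (z 2) (z 3) 1 0 1 0) (sl C (z 2) (z 3) 0 1 1 0) (sl C (z 2) (z 3) 1 0 0 1) (sl C (z 2) (z 3) 0 1 0 1) (sl C (z 2) (z 3) 1 0 0 0) (sl C (z 2) (z 3) 0 1 0 0) (sl C (z 2) (z 3) 0 0 2 0) (sl C (z 2) (z 3) 0 0 1 1) (sl C (z 2) (z 3) 0 0 0 2) (sl C (z 2) (z 3) 0 0 1 0) (sl C (z 2) (z 3) 0 0 0 1) (sl C (z 2) (z 3) 0 0 0 0)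
      (sl_Sm hC (z 2) (z 3) 2 0 0 0) (sl_Sm hC (z 2) (z 3) 1 1 0 0) (sl_Sm hC (z 2) (z 3) 0 2 0 0) (sl_Sm hC (z 2) (z 3) 1 0 1 0) (sl_Sm hC (z 2) (z 3) 0 1 1 0) (sl_Sm hC (z 2) (z 3) 1 0 0 1) (sl_Sm hC (z 2) (z 3) 0 1 0 1) (sl_Sm hC (z 2) (z 3) 1 0 0 0) (sl_Sm hC (z 2) (z 3) 0 1 0 0) (sl_Sm hC (z 2) (z 3) 0 0 2 0) (sl_Sm hC (z 2) (z 3) 0 0 1 1) (sl_Sm hC (z 2) (z 3) 0 0 0 2) (sl_Sm hC (z 2) (z 3) 0 0 1 0) (sl_Sm hC (z 2) (z 3) 0 0 0 1) (sl_Sm hC (z 2) (z 3) 0 0 0 0)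
      (by
        intro x y hp p q r s
        have hm := mk_mem (z 2) (z 3) p q r s (Om'_of hp)
        obtain ⟨i0, i1, i4, i5⟩ := hpdI x y hp p q r s
        obtain ⟨k0, k1, k2, k3, k4, k5⟩ := HamD_pd d (z 2) (z 3) p q r s (Om'_of hp)
        have hb := (hpois _ hm).2.2.2.1
        unfold pois at hb
        rw [hpd2 _ hm, hpd3 _ hm, k0, k1, k2, k3, k4, k5, i0, i1, i4, i5] at hb
        linear_combination hb)
      (z 0) (z 1) hzO hzN
  have hzT : z ∈ TStar := hST hzS
  obtain ⟨i0, i1, i4, i5⟩ := hpdI (z 0) (z 1) hzO (z 4) (z 5) (z 6) (z 7)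
  obtain ⟨k0, k1, k2, k3, k4, k5⟩ := HamD_pd d (z 2) (z 3) (z 4) (z 5) (z 6) (z 7) (Om'_of hzO)
  obtain ⟨l0, l1, l4, l5⟩ := hl (z 4) (z 5) (z 6) (z 7)
  rw [mk_eta] at i0 i1 i4 i5 k0 k1 k2 k3 k4 k5
  refine fderiv_comb I (HamD d) z l ?_ ?_ ?_ ?_ ?_ ?_ (hL z hzS)
  · rw [i0, k0, l0]
  · rw [i1, k1, l1]
  · rw [hpd2 z hzT, k2, mul_zero]
  · rw [hpd3 z hzT, k3, mul_zero]
  · rw [i4, k4, l4]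
  · rw [i5, k5, l5]

end
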